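/- Let K be a field of arbitrary characteristic and let A be an affine line arrangement in K² with |A| = 2n + r, n, r ∈ ℤ_{≥0}, and χ(A,t) = (t − n)(t − n − r). Assume that A contains a free subarrangement B with exp₀(B) = (n − s, n − 1) where −r ≤ s ≤ 0. Then A is free if and only if n_H ∈ {n, n + r} for some line H ∈ A. -/

import Mathlib

open MvPolynomial

variable {K : Type*} [Field K]

/-- A subset of `K × K` is an affine line: the zero set of a nonzero degree-one equation. -/
def IsAffineLine (L : Set (K × K)) : Prop :=
  ∃ a b c : K, (a, b) ≠ (0, 0) ∧ L = {p : K × K | a * p.1 + b * p.2 + c = 0}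

/-- An affine line arrangement: a finite set of affine lines in `K²`. -/
def IsLineArr (A : Finset (Set (K × K))) : Prop :=
  ∀ L ∈ A, IsAffineLine L

open Classical in
/-- The second Betti number `b₂(A)` of a line arrangement, via Whitney's theorem:
`b₂(A) = ∑ (-1)^{|B|}` over the subsets `B ⊆ A` with `|B| ≥ 2` and `⋂ B ≠ ∅`. -/
noncomputable def b2 (A : Finset (Set (K × K))) : ℤ :=
  ∑ B ∈ A.powerset.filter
      (fun B : Finset (Set (K × K)) => 2 ≤ B.card ∧ (⋂ L ∈ B, (L : Set (K × K))).Nonempty),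
    (-1 : ℤ) ^ B.card

/-- The characteristic polynomial `χ(A,t) = t² − |A|·t + b₂(A)`, evaluated at `t : ℂ`. -/
noncomputable def chi (A : Finset (Set (K × K))) (t : ℂ) : ℂ :=
  t ^ 2 - (A.card : ℂ) * t + (b2 A : ℂ)

/-- `nOn A H = |A ∩ H|`: the number of intersection points, lying on the line `H`, of `H`
with the lines of `A` other than `H`. -/
noncomputable def nOn (A : Finset (Set (K × K))) (H : Set (K × K)) : ℕ :=
  Set.ncard {p : K × K | p ∈ H ∧ ∃ L ∈ A, L ≠ H ∧ p ∈ L}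

/-- The linear form `a·x + b·y + c·z` in `K[x,y,z]`. -/
noncomputable def lin3 (a b c : K) : MvPolynomial (Fin 3) K :=
  C a * X 0 + C b * X 1 + C c * X 2

/-- The action on `f` of the derivation with coefficient vector `θ`. -/
noncomputable def applyDer3 (θ : Fin 3 → MvPolynomial (Fin 3) K)
    (f : MvPolynomial (Fin 3) K) : MvPolynomial (Fin 3) K :=
  ∑ i, θ i * pderiv i f

/-- `θ` belongs to `D(cA)`, the logarithmic derivation module of the cone of `A`:
`θ(α_H) ∈ S·α_H` for every `H ∈ cA`, where `cA` consists of the homogenizations of the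
lines of `A` together with the plane `z = 0`. -/
def InDCone (A : Finset (Set (K × K))) (θ : Fin 3 → MvPolynomial (Fin 3) K) : Prop :=
  (∀ L ∈ A, ∀ a b c : K, (a, b) ≠ (0, 0) →
      L = {p : K × K | a * p.1 + b * p.2 + c = 0} →
      ∃ g, applyDer3 θ (lin3 a b c) = g * lin3 a b c) ∧
  (∃ g, applyDer3 θ (X 2) = g * (X 2 : MvPolynomial (Fin 3) K))

/-- A homogeneous derivation of degree `d` on `K[x,y,z]`. -/
def HomogDer3 (θ : Fin 3 → MvPolynomial (Fin 3) K) (d : ℕ) : Prop :=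
  ∀ i, (θ i).IsHomogeneous d

/-- `A` is free with exponents `exp₀(A) = (d₁, d₂)`: `D(cA)` is a free module with a
homogeneous basis consisting of the Euler derivation `x∂ₓ + y∂_y + z∂_z` and two
derivations of degrees `d₁` and `d₂`. -/
def IsFreeExp (A : Finset (Set (K × K))) (d₁ d₂ : ℕ) : Prop :=
  ∃ θ₁ θ₂ : Fin 3 → MvPolynomial (Fin 3) K,
    InDCone A θ₁ ∧ InDCone A θ₂ ∧ HomogDer3 θ₁ d₁ ∧ HomogDer3 θ₂ d₂ ∧
    ∀ θ : Fin 3 → MvPolynomial (Fin 3) K, InDCone A θ →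
      ∃! cfs : MvPolynomial (Fin 3) K × MvPolynomial (Fin 3) K × MvPolynomial (Fin 3) K,
        θ = fun j => cfs.1 * X j + cfs.2.1 * θ₁ j + cfs.2.2 * θ₂ j

/-- `A` is free (with some exponents). -/
def IsFree (A : Finset (Set (K × K))) : Prop := ∃ d₁ d₂ : ℕ, IsFreeExp A d₁ d₂

/-- `A` is free with (integer-valued) exponents `exp₀(A) = (d₁, d₂)`. -/
def IsFreeExpZ (A : Finset (Set (K × K))) (d₁ d₂ : ℤ) : Prop :=
  ∃ e₁ e₂ : ℕ, (e₁ : ℤ) = d₁ ∧ (e₂ : ℤ) = d₂ ∧ IsFreeExp A e₁ e₂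

section Homogeneous

theorem finrank_homogeneousSubmodule_fin_three (k : ℕ) :
    Module.finrank K (homogeneousSubmodule (Fin 3) K k) = (k + 2).choose 2 := by
  have h : homogeneousSubmodule (Fin 3) K k =
      restrictSupport K (↑((Finset.univ : Finset (Fin 3)).finsuppAntidiag k) : Set (Fin 3 →₀ ℕ)) := by
    rw [homogeneousSubmodule_eq_finsupp_supported, restrictSupport]
    congr 1
    ext d
    simp [Finsupp.degree_eq_sum, Finset.mem_finsuppAntidiag]
  rw [h, Module.finrank_eq_nat_card_basis (basisRestrictSupport K _)]
  simp only [Finset.coe_sort_coe, Nat.card_eq_fintype_card, Fintype.card_coe,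
    Finset.card_finsuppAntidiag_nat_eq_choose, Finset.card_univ, Fintype.card_fin]
  rw [show 3 + k - 1 = k + 2 by omega]
  exact Nat.choose_symm_of_eq_add rfl

instance finite_homogeneousSubmodule (k : ℕ) :
    Module.Finite K (homogeneousSubmodule (Fin 3) K k) :=
  Module.Finite.iff_fg.mpr (homogeneousSubmodule_fg _ _ _)

theorem homogeneousComponent_mul_of_isHomogeneous {p : MvPolynomial (Fin 3) K} {m : ℕ}
    (hp : p.IsHomogeneous m) (q : MvPolynomial (Fin 3) K) (j : ℕ) :
    homogeneousComponent (m + j) (p * q) = p * homogeneousComponent j q := by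
  conv_lhs => rw [← sum_homogeneousComponent q, Finset.mul_sum, map_sum]
  have h : ∀ i, homogeneousComponent (m + j) (p * homogeneousComponent i q) =
      if i = j then p * homogeneousComponent j q else 0 := fun i => by
    rw [homogeneousComponent_of_mem (hp.mul (homogeneousComponent_isHomogeneous i q))]
    by_cases hij : i = j
    · simp [hij]
    · rw [if_neg (by omega), if_neg hij]
  simp only [h, Finset.sum_ite_eq', Finset.mem_range]
  split_ifs with hj
  · rfl
  · rw [homogeneousComponent_eq_zero _ _ (by omega), mul_zero]

theorem homogeneousComponent_mul_of_lt {p : MvPolynomial (Fin 3) K} {m : ℕ}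
    (hp : p.IsHomogeneous m) (q : MvPolynomial (Fin 3) K) {n : ℕ} (hn : n < m) :
    homogeneousComponent n (p * q) = 0 := by
  conv_lhs => rw [← sum_homogeneousComponent q, Finset.mul_sum, map_sum]
  refine Finset.sum_eq_zero fun i _ => ?_
  rw [homogeneousComponent_of_mem (hp.mul (homogeneousComponent_isHomogeneous i q)),
    if_neg (by omega)]

theorem MvPolynomial.IsHomogeneous.of_mul_left {p q : MvPolynomial (Fin 3) K} {m k : ℕ}
    (hp : p.IsHomogeneous m) (hp0 : p ≠ 0) (hpq : (p * q).IsHomogeneous (m + k)) :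
    q.IsHomogeneous k := by
  have h := homogeneousComponent_mul_of_isHomogeneous hp q k
  rw [homogeneousComponent_eq_self hpq] at h
  rw [mul_left_cancel₀ hp0 h]
  exact homogeneousComponent_isHomogeneous k q

theorem MvPolynomial.IsHomogeneous.eq_zero_of_mul_left {p q : MvPolynomial (Fin 3) K} {m n : ℕ}
    (hp : p.IsHomogeneous m) (hpq : (p * q).IsHomogeneous n) (hn : n < m) : p * q = 0 := by
  have h := homogeneousComponent_mul_of_lt hp q hn
  rwa [homogeneousComponent_eq_self hpq] at h

end Homogeneous

section LinearForms

theorem lin3_isHomogeneous (a b c : K) : (lin3 a b c).IsHomogeneous 1 :=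
  ((isHomogeneous_C_mul_X a 0).add (isHomogeneous_C_mul_X b 1)).add (isHomogeneous_C_mul_X c 2)

theorem lin3_smul (u a b c : K) : lin3 (u * a) (u * b) (u * c) = C u * lin3 a b c := by
  simp only [lin3, C_mul]; ring

theorem coeff_lin3 (a b c : K) :
    coeff (Finsupp.single 0 1) (lin3 a b c) = a ∧ coeff (Finsupp.single 1 1) (lin3 a b c) = b ∧
      coeff (Finsupp.single 2 1) (lin3 a b c) = c := by
  refine ⟨?_, ?_, ?_⟩ <;> simp [lin3, coeff_C_mul, coeff_X, Finsupp.single_left_inj]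

theorem lin3_ne_zero {a b c : K} (h : (a, b) ≠ (0, 0)) : lin3 a b c ≠ 0 := by
  intro h0
  obtain ⟨h1, h2, -⟩ := coeff_lin3 a b c
  rw [h0, coeff_zero] at h1 h2
  exact h (by rw [← h1, ← h2])

theorem lin3_prime {a b c : K} (h : (a, b) ≠ (0, 0)) : Prime (lin3 a b c) := by
  refine (irreducible_of_totalDegree_eq_one
    ((lin3_isHomogeneous a b c).totalDegree (lin3_ne_zero h)) fun x hx => ?_).prime
  obtain ⟨h1, h2, -⟩ := coeff_lin3 a b c
  have ha := hx (Finsupp.single 0 1)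
  have hb := hx (Finsupp.single 1 1)
  rw [h1] at ha
  rw [h2] at hb
  rw [isUnit_iff_ne_zero]
  rintro rfl
  exact h (by rw [zero_dvd_iff.mp ha, zero_dvd_iff.mp hb])

theorem exists_dual {a b : K} (h : (a, b) ≠ (0, 0)) : ∃ e₁ e₂ : K, e₂ * a - e₁ * b = 1 := by
  by_cases ha : a = 0
  · have hb : b ≠ 0 := fun hb => h (by rw [ha, hb])
    exact ⟨-b⁻¹, 0, by field_simp; simp⟩
  · exact ⟨0, a⁻¹, by field_simp; simp⟩

/-- Restriction of polynomials to the affine line `t ↦ p + t • d` in the chart `z = 1`. -/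
noncomputable def restrictLine (p d : K × K) : MvPolynomial (Fin 3) K →ₐ[K] Polynomial K :=
  aeval ![Polynomial.C p.1 + Polynomial.C d.1 * Polynomial.X,
    Polynomial.C p.2 + Polynomial.C d.2 * Polynomial.X, 1]

theorem restrictLine_lin3 (p d : K × K) (a b c : K) :
    restrictLine p d (lin3 a b c) = Polynomial.C (a * p.1 + b * p.2 + c) +
      Polynomial.C (a * d.1 + b * d.2) * Polynomial.X := by
  simp only [restrictLine, lin3, map_add, map_mul, aeval_X, algHom_C, Matrix.cons_val,
    Polynomial.algebraMap_eq]
  ring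

theorem natDegree_restrictLine_le (p d : K × K) {f : MvPolynomial (Fin 3) K} {k : ℕ}
    (hf : f.IsHomogeneous k) : (restrictLine p d f).natDegree ≤ k := by
  rw [← mul_one k]
  refine aeval_natDegree_le f hf.totalDegree_le _ fun i => ?_
  fin_cases i
  · exact (Polynomial.natDegree_add_le _ _).trans
      (max_le (by simp) ((Polynomial.natDegree_C_mul_le _ _).trans Polynomial.natDegree_X_le))
  · exact (Polynomial.natDegree_add_le _ _).trans
      (max_le (by simp) ((Polynomial.natDegree_C_mul_le _ _).trans Polynomial.natDegree_X_le))
  · simp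

theorem aeval_mul_of_isHomogeneous {R : Type*} [CommRing R] [Algebra K R] (r : R)
    (g : Fin 3 → R) {f : MvPolynomial (Fin 3) K} {k : ℕ} (hf : f.IsHomogeneous k) :
    aeval (fun i => r * g i) f = r ^ k * aeval g f := by
  rw [aeval_def, aeval_def, eval₂_eq', eval₂_eq', Finset.mul_sum]
  refine Finset.sum_congr rfl fun m hm => ?_
  have hk : ∑ i, m i = k := by
    rw [hf.degree_eq_sum_deg_support hm, ← Finsupp.degree_apply, Finsupp.degree_eq_sum]
  simp only [mul_pow, Finset.prod_mul_distrib, Finset.prod_pow_eq_pow_sum, hk]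
  ring

theorem dvd_sub_aeval {R : Type*} [CommRing R] [Algebra K R] {α : R} {g h : Fin 3 → R}
    (hgh : ∀ i, α ∣ g i - h i) (f : MvPolynomial (Fin 3) K) : α ∣ aeval g f - aeval h f := by
  rw [← Ideal.mem_span_singleton, ← Ideal.Quotient.mk_eq_mk_iff_sub_mem]
  have key : ∀ u : Fin 3 → R, Ideal.Quotient.mk (Ideal.span {α}) (aeval u f) =
      aeval (fun i => Ideal.Quotient.mk (Ideal.span {α}) (u i)) f := fun u => by
    have := (map_aeval u (Ideal.Quotient.mk (Ideal.span {α})) f)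
    rw [this, aeval_def, coe_eval₂Hom]
    rfl
  rw [key, key]
  congr 2
  ext i
  rw [Ideal.Quotient.mk_eq_mk_iff_sub_mem, Ideal.mem_span_singleton]
  exact hgh i

theorem lin3_dvd_of_restrictLine_eq_zero {a b c : K} (h : (a, b) ≠ (0, 0)) {p : K × K}
    (hp : a * p.1 + b * p.2 + c = 0) {f : MvPolynomial (Fin 3) K} {k : ℕ}
    (hf : f.IsHomogeneous k) (h0 : restrictLine p (-b, a) f = 0) : lin3 a b c ∣ f := by
  obtain ⟨e₁, e₂, he⟩ := exists_dual h
  set E : MvPolynomial (Fin 3) K := lin3 e₁ e₂ (-(e₁ * p.1 + e₂ * p.2)) with hE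
  set σ : Fin 3 → MvPolynomial (Fin 3) K :=
    ![C p.1 * X 2 - C b * E, C p.2 * X 2 + C a * E, X 2] with hσ
  have hc : c = -(a * p.1 + b * p.2) := by linear_combination hp
  have heC : (C e₂ * C a - C e₁ * C b : MvPolynomial (Fin 3) K) = 1 := by
    rw [← C_mul, ← C_mul, ← C_sub, he, C_1]
  have hdvd : lin3 a b c ∣ aeval X f - aeval σ f := by
    refine dvd_sub_aeval (fun i => ?_) f
    subst hc
    fin_cases i
    · refine ⟨C e₂, ?_⟩
      simp only [hσ, hE, lin3, Fin.zero_eta, Matrix.cons_val_zero, C_neg, C_add, C_mul]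
      linear_combination (C p.1 * X 2 - X 0) * heC
    · refine ⟨-C e₁, ?_⟩
      simp only [hσ, hE, lin3, Fin.mk_one, Matrix.cons_val_one, Matrix.cons_val_zero, C_neg,
        C_add, C_mul]
      linear_combination (C p.2 * X 2 - X 1) * heC
    · simp [hσ]
  have hσ0 : aeval σ f = 0 := by
    let F := FractionRing (MvPolynomial (Fin 3) K)
    have hinj : Function.Injective (algebraMap (MvPolynomial (Fin 3) K) F) :=
      IsFractionRing.injective _ _
    set z : F := algebraMap (MvPolynomial (Fin 3) K) F (X 2) with hz
    set y : F := algebraMap (MvPolynomial (Fin 3) K) F E with hy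
    have hz0 : z ≠ 0 := by
      rw [hz, Ne, map_eq_zero_iff _ hinj]
      exact X_ne_zero 2
    have hyz : z * (y / z) = y := mul_div_cancel₀ y hz0
    have h1 : (Polynomial.aeval (y / z)) (restrictLine p (-b, a) f) =
        aeval (fun i => Polynomial.aeval (y / z)
          ((![Polynomial.C p.1 + Polynomial.C (-b) * Polynomial.X,
            Polynomial.C p.2 + Polynomial.C a * Polynomial.X, 1] : Fin 3 → Polynomial K) i)) f := by
      rw [restrictLine, ← AlgHom.comp_apply, comp_aeval]
    apply hinj
    rw [map_zero]
    have h2 : algebraMap (MvPolynomial (Fin 3) K) F (aeval σ f) =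
        aeval (fun i => algebraMap (MvPolynomial (Fin 3) K) F (σ i)) f :=
      (aeval_algebraMap_apply F σ f).symm
    have h3 : (fun i => algebraMap (MvPolynomial (Fin 3) K) F (σ i)) =
        fun i => z * Polynomial.aeval (y / z)
          ((![Polynomial.C p.1 + Polynomial.C (-b) * Polynomial.X,
            Polynomial.C p.2 + Polynomial.C a * Polynomial.X, 1] : Fin 3 → Polynomial K) i) := by
      have hC : ∀ u : K, algebraMap (MvPolynomial (Fin 3) K) F (C u) = algebraMap K F u :=
        fun u => by
          rw [IsScalarTower.algebraMap_apply K (MvPolynomial (Fin 3) K) F]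
          rfl
      funext i
      fin_cases i
      · simp only [hσ, Fin.zero_eta, Matrix.cons_val_zero, map_sub, map_add, map_mul, hC, map_neg,
          Polynomial.aeval_C, Polynomial.aeval_X, ← hz, ← hy]
        linear_combination algebraMap K F b * hyz
      · simp only [hσ, Fin.mk_one, Matrix.cons_val_one, Matrix.cons_val_zero, map_add, map_mul, hC,
          Polynomial.aeval_C, Polynomial.aeval_X, ← hz, ← hy]
        linear_combination -(algebraMap K F a) * hyz
      · simp [hσ, hz]
    rw [h2, h3, aeval_mul_of_isHomogeneous _ _ hf, ← h1, h0, map_zero, mul_zero]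
  rw [hσ0, sub_zero] at hdvd
  simpa using hdvd

end LinearForms

section Lines

/-- The affine line with equation `a x + b y + c = 0`. -/
def affineLine (a b c : K) : Set (K × K) := {p : K × K | a * p.1 + b * p.2 + c = 0}

theorem mem_affineLine {a b c : K} {p : K × K} :
    p ∈ affineLine a b c ↔ a * p.1 + b * p.2 + c = 0 := Iff.rfl

theorem affineLine_nonempty {a b : K} (h : (a, b) ≠ (0, 0)) (c : K) :
    ∃ p : K × K, a * p.1 + b * p.2 + c = 0 := by
  by_cases ha : a = 0
  · have hb : b ≠ 0 := fun hb => h (by rw [ha, hb])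
    exact ⟨(0, -c / b), by field_simp; simp⟩
  · exact ⟨(-c / a, 0), by field_simp; simp⟩

theorem exists_smul_eq_of_mul_eq_mul {a b a' b' : K} (h : (a, b) ≠ (0, 0))
    (hd : a' * b = b' * a) : ∃ u : K, a' = u * a ∧ b' = u * b := by
  by_cases ha : a = 0
  · have hb : b ≠ 0 := fun hb => h (by rw [ha, hb])
    refine ⟨b' / b, ?_, by field_simp⟩
    field_simp
    exact hd
  · refine ⟨a' / a, by field_simp, ?_⟩
    field_simp
    exact hd.symm

theorem affineLine_smul {u : K} (hu : u ≠ 0) (a b c : K) :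
    affineLine (u * a) (u * b) (u * c) = affineLine a b c := by
  ext p
  rw [mem_affineLine, mem_affineLine,
    show u * a * p.1 + u * b * p.2 + u * c = u * (a * p.1 + b * p.2 + c) by ring,
    mul_eq_zero, or_iff_right hu]

theorem exists_smul_of_parallel_of_mem {a b c a' b' c' : K} (h : (a, b) ≠ (0, 0))
    (h' : (a', b') ≠ (0, 0)) (hd : a' * b = b' * a) {p : K × K}
    (hp : p ∈ affineLine a b c) (hp' : p ∈ affineLine a' b' c') :
    ∃ u : K, u ≠ 0 ∧ a' = u * a ∧ b' = u * b ∧ c' = u * c := by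
  obtain ⟨u, rfl, rfl⟩ := exists_smul_eq_of_mul_eq_mul h hd
  rw [mem_affineLine] at hp hp'
  refine ⟨u, ?_, rfl, rfl, by linear_combination hp' - u * hp⟩
  rintro rfl
  exact h' (by simp)

theorem exists_smul_of_affineLine_eq {a b c a' b' c' : K} (h : (a, b) ≠ (0, 0))
    (h' : (a', b') ≠ (0, 0)) (he : affineLine a b c = affineLine a' b' c') :
    ∃ u : K, u ≠ 0 ∧ a' = u * a ∧ b' = u * b ∧ c' = u * c := by
  obtain ⟨p, hp⟩ := affineLine_nonempty h c
  have hp' : p ∈ affineLine a' b' c' := he ▸ hp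
  have hq : (p.1 - b, p.2 + a) ∈ affineLine a b c := by
    rw [mem_affineLine]; linear_combination hp
  have hq' : (p.1 - b, p.2 + a) ∈ affineLine a' b' c' := he ▸ hq
  refine exists_smul_of_parallel_of_mem h h' ?_ hp hp'
  rw [mem_affineLine] at hp' hq'
  linear_combination hp' - hq'

theorem affineLine_eq_of_lin3_dvd {a b c a' b' c' : K} (h' : (a', b') ≠ (0, 0))
    (hd : lin3 a b c ∣ lin3 a' b' c') : affineLine a b c = affineLine a' b' c' := by
  obtain ⟨q, hq⟩ := hd
  have hl : lin3 a b c ≠ 0 := by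
    intro h0
    rw [h0, zero_mul] at hq
    exact lin3_ne_zero h' hq
  have hq0 : q.IsHomogeneous 0 :=
    (lin3_isHomogeneous a b c).of_mul_left hl (hq ▸ lin3_isHomogeneous a' b' c')
  obtain ⟨u, rfl⟩ : ∃ u, q = C u :=
    ⟨_, totalDegree_eq_zero_iff_eq_C.mp (Nat.le_zero.mp hq0.totalDegree_le)⟩
  rw [mul_comm, ← lin3_smul] at hq
  obtain ⟨h1, h2, h3⟩ := coeff_lin3 a' b' c'
  obtain ⟨g1, g2, g3⟩ := coeff_lin3 (u * a) (u * b) (u * c)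
  rw [hq] at h1 h2 h3
  rw [← h1, ← h2, ← h3, g1, g2, g3, affineLine_smul]
  rintro rfl
  exact h' (by rw [← h1, ← h2, g1, g2]; simp)

theorem isRelPrime_lin3 {a b c a' b' c' : K} (h : (a, b) ≠ (0, 0)) (h' : (a', b') ≠ (0, 0))
    (hne : affineLine a b c ≠ affineLine a' b' c') :
    IsRelPrime (lin3 a b c) (lin3 a' b' c') :=
  (lin3_prime h).irreducible.isRelPrime_iff_not_dvd.mpr
    fun hd => hne (affineLine_eq_of_lin3_dvd h' hd)

end Lines

section LogModule

/-- The pairs `(f, g)` for which the derivation `f ∂ₓ + g ∂_y` is logarithmic along the cone of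
`A`. -/
noncomputable def logModule (A : Finset (Set (K × K))) :
    Submodule (MvPolynomial (Fin 3) K) (MvPolynomial (Fin 3) K × MvPolynomial (Fin 3) K) where
  carrier := {η | ∀ L ∈ A, ∀ a b c : K, (a, b) ≠ (0, 0) → L = affineLine a b c →
    lin3 a b c ∣ C a * η.1 + C b * η.2}
  add_mem' {η ξ} hη hξ L hL a b c h hl := by
    have := dvd_add (hη L hL a b c h hl) (hξ L hL a b c h hl)
    convert this using 1
    simp only [Prod.fst_add, Prod.snd_add]
    ring
  zero_mem' L hL a b c h hl := by simp
  smul_mem' f η hη L hL a b c h hl := by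
    have := dvd_mul_of_dvd_right (hη L hL a b c h hl) f
    convert this using 1
    simp only [Prod.smul_fst, Prod.smul_snd, smul_eq_mul]
    ring

theorem mem_logModule {A : Finset (Set (K × K))}
    {η : MvPolynomial (Fin 3) K × MvPolynomial (Fin 3) K} :
    η ∈ logModule A ↔ ∀ L ∈ A, ∀ a b c : K, (a, b) ≠ (0, 0) → L = affineLine a b c →
      lin3 a b c ∣ C a * η.1 + C b * η.2 := Iff.rfl

theorem logModule_anti {A B : Finset (Set (K × K))} (h : B ⊆ A) : logModule A ≤ logModule B :=
  fun _ hη L hL => hη L (h hL)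

theorem lin3_dvd_of_affineLine_eq {a b c a' b' c' : K} (h : (a, b) ≠ (0, 0))
    (h' : (a', b') ≠ (0, 0)) (he : affineLine a b c = affineLine a' b' c')
    {η : MvPolynomial (Fin 3) K × MvPolynomial (Fin 3) K}
    (hd : lin3 a b c ∣ C a * η.1 + C b * η.2) : lin3 a' b' c' ∣ C a' * η.1 + C b' * η.2 := by
  obtain ⟨u, -, rfl, rfl, rfl⟩ := exists_smul_of_affineLine_eq h h' he
  rw [lin3_smul, C_mul, C_mul, mul_assoc, mul_assoc, ← mul_add]
  exact mul_dvd_mul_left _ hd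

open Classical in
theorem mem_logModule_insert {A : Finset (Set (K × K))} {a b c : K} (h : (a, b) ≠ (0, 0))
    {η : MvPolynomial (Fin 3) K × MvPolynomial (Fin 3) K} :
    η ∈ logModule (insert (affineLine a b c) A) ↔
      η ∈ logModule A ∧ lin3 a b c ∣ C a * η.1 + C b * η.2 := by
  refine ⟨fun hη => ⟨logModule_anti (Finset.subset_insert _ _) hη,
    hη _ (Finset.mem_insert_self _ _) a b c h rfl⟩, fun ⟨h1, h2⟩ L hL a' b' c' h' hl => ?_⟩
  rcases Finset.mem_insert.mp hL with rfl | hL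
  · exact lin3_dvd_of_affineLine_eq h h' hl h2
  · exact h1 L hL a' b' c' h' hl

/-- The homogeneous part of degree `k` of `logModule A`. -/
noncomputable def logDeg (A : Finset (Set (K × K))) (k : ℕ) :
    Submodule K (MvPolynomial (Fin 3) K × MvPolynomial (Fin 3) K) :=
  (logModule A).restrictScalars K ⊓
    (homogeneousSubmodule (Fin 3) K k).prod (homogeneousSubmodule (Fin 3) K k)

theorem mem_logDeg {A : Finset (Set (K × K))} {k : ℕ}
    {η : MvPolynomial (Fin 3) K × MvPolynomial (Fin 3) K} :
    η ∈ logDeg A k ↔ η ∈ logModule A ∧ η.1.IsHomogeneous k ∧ η.2.IsHomogeneous k := Iff.rfl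

instance finite_logDeg (A : Finset (Set (K × K))) (k : ℕ) : Module.Finite K (logDeg A k) :=
  haveI := Module.Finite.iff_fg.mpr
    ((homogeneousSubmodule_fg (Fin 3) K k).prod (homogeneousSubmodule_fg (Fin 3) K k))
  Submodule.finiteDimensional_of_le inf_le_right

theorem finrank_logDeg_empty (k : ℕ) :
    Module.finrank K (logDeg (∅ : Finset (Set (K × K))) k) = 2 * (k + 2).choose 2 := by
  let e : logDeg (∅ : Finset (Set (K × K))) k ≃ₗ[K]
      homogeneousSubmodule (Fin 3) K k × homogeneousSubmodule (Fin 3) K k :=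
    { toFun := fun x => (⟨x.1.1, x.2.2.1⟩, ⟨x.1.2, x.2.2.2⟩)
      map_add' := fun _ _ => rfl
      map_smul' := fun _ _ => rfl
      invFun := fun x => ⟨(x.1.1, x.2.1), fun L hL => absurd hL (Finset.notMem_empty L),
        x.1.2, x.2.2⟩
      left_inv := fun _ => rfl
      right_inv := fun _ => rfl }
  rw [e.finrank_eq, Module.finrank_prod, finrank_homogeneousSubmodule_fin_three, two_mul]

end LogModule

section Dimension

theorem finrank_le_finrank_add {V W : Type*} [AddCommGroup V] [Module K V] [AddCommGroup W]
    [Module K W] (f : V →ₗ[K] W) (P P' : Submodule K V) (Q : Submodule K W) [Module.Finite K P]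
    [Module.Finite K P'] [Module.Finite K Q] (h₁ : ∀ x ∈ P, f x ∈ Q)
    (h₂ : ∀ x ∈ P, f x = 0 → x ∈ P') :
    Module.finrank K P ≤ Module.finrank K P' + Module.finrank K Q := by
  have h := (f.domRestrict P).finrank_range_add_finrank_ker
  have hr : Module.finrank K (LinearMap.range (f.domRestrict P)) ≤ Module.finrank K Q := by
    refine Submodule.finrank_mono ?_
    rintro _ ⟨x, rfl⟩
    exact h₁ x x.2
  have hk : Module.finrank K (LinearMap.ker (f.domRestrict P)) ≤ Module.finrank K P' := by
    rw [← Submodule.finrank_map_subtype_eq]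
    refine Submodule.finrank_mono ?_
    rintro _ ⟨x, hx, rfl⟩
    exact h₂ x x.2 hx
  omega

theorem mem_map_mulLeft_degreeLT {Q h : Polynomial K} {m : ℕ} (hh : h.natDegree < m ∨ h = 0)
    (hd : Q ∣ h) : h ∈ (Polynomial.degreeLT K (m - Q.natDegree)).map (LinearMap.mulLeft K Q) := by
  obtain ⟨q, rfl⟩ := hd
  by_cases h0 : Q * q = 0
  · rw [h0]; exact Submodule.zero_mem _
  · have hq : q ≠ 0 := right_ne_zero_of_mul h0
    have hQ : Q ≠ 0 := left_ne_zero_of_mul h0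
    refine ⟨q, ?_, rfl⟩
    have := hh.resolve_right h0
    rw [Polynomial.natDegree_mul hQ hq] at this
    rw [SetLike.mem_coe, Polynomial.mem_degreeLT, Polynomial.degree_eq_natDegree hq]
    exact_mod_cast (by omega : q.natDegree < m - Q.natDegree)

instance finite_degreeLT (m : ℕ) : Module.Finite K (Polynomial.degreeLT K m) :=
  Module.Finite.equiv (Polynomial.degreeLTEquiv K m).symm

theorem finrank_map_mulLeft_degreeLT_le (Q : Polynomial K) (m : ℕ) :
    Module.finrank K ((Polynomial.degreeLT K m).map (LinearMap.mulLeft K Q)) ≤ m := by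
  refine (Submodule.finrank_map_le _ _).trans ?_
  rw [(Polynomial.degreeLTEquiv K m).finrank_eq, Module.finrank_fin_fun]

/-- Equations for the lines of an arrangement. -/
structure IsEquationSystem (A : Finset (Set (K × K))) (α β γ : Set (K × K) → K) : Prop where
  ne_zero : ∀ L ∈ A, (α L, β L) ≠ (0, 0)
  eq : ∀ L ∈ A, L = affineLine (α L) (β L) (γ L)

theorem IsLineArr.exists_isEquationSystem {A : Finset (Set (K × K))} (hA : IsLineArr A) :
    ∃ α β γ, IsEquationSystem A α β γ := by
  choose! α β γ h using hA
  exact ⟨α, β, γ, fun L hL => (h L hL).1, fun L hL => (h L hL).2⟩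

/-- The parameter at which the line `t ↦ p + t • (-b, a)` meets `α x + β y + γ = 0`. -/
noncomputable def meetParam (a b : K) (p : K × K) (α β γ : K) : K :=
  -(α * p.1 + β * p.2 + γ) / (β * a - α * b)

theorem meetParam_spec {a b : K} {p : K × K} {α β γ : K} (h : β * a - α * b ≠ 0) :
    α * p.1 + β * p.2 + γ = -(meetParam a b p α β γ * (β * a - α * b)) := by
  rw [meetParam, div_mul_cancel₀ _ h, neg_neg]

theorem restrictLine_lin3_of_ne {a b : K} {p : K × K} {α β γ : K} (h : β * a - α * b ≠ 0) :
    restrictLine p (-b, a) (lin3 α β γ) = Polynomial.C (β * a - α * b) *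
      (Polynomial.X - Polynomial.C (meetParam a b p α β γ)) := by
  rw [restrictLine_lin3, meetParam_spec h]
  simp only [Polynomial.C_neg, Polynomial.C_mul, Polynomial.C_add, Polynomial.C_sub]
  ring

theorem exists_param {a b c : K} (h : (a, b) ≠ (0, 0)) {p q : K × K}
    (hp : p ∈ affineLine a b c) (hq : q ∈ affineLine a b c) :
    ∃ t : K, q = (p.1 - t * b, p.2 + t * a) := by
  rw [mem_affineLine] at hp hq
  obtain ⟨u, h1, h2⟩ := exists_smul_eq_of_mul_eq_mul (a := -b) (b := a)
    (a' := q.1 - p.1) (b' := q.2 - p.2) (by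
      intro h0
      simp only [Prod.mk.injEq, neg_eq_zero] at h0
      exact h (by rw [h0.1, h0.2])) (by linear_combination hq - hp)
  exact ⟨u, Prod.ext (by linear_combination h1) (by linear_combination h2)⟩

open Classical in
/-- The parameters of the points where the lines of `A` meet the line `t ↦ p + t • (-b, a)`. -/
noncomputable def meetParams (A : Finset (Set (K × K))) (α β γ : Set (K × K) → K) (a b : K)
    (p : K × K) : Finset K :=
  (A.filter fun L => β L * a - α L * b ≠ 0).image fun L => meetParam a b p (α L) (β L) (γ L)

open Classical in
theorem mem_meetParams_iff {A : Finset (Set (K × K))} {α β γ : Set (K × K) → K}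
    (hA : IsEquationSystem A α β γ) {a b c : K} (h : (a, b) ≠ (0, 0))
    (hH : affineLine a b c ∉ A) {p : K × K} (hp : p ∈ affineLine a b c) (t : K) :
    t ∈ meetParams A α β γ a b p ↔ ∃ L ∈ A, (p.1 - t * b, p.2 + t * a) ∈ L := by
  have hq : (p.1 - t * b, p.2 + t * a) ∈ affineLine a b c := by
    rw [mem_affineLine] at hp ⊢
    linear_combination hp
  simp only [meetParams, Finset.mem_image, Finset.mem_filter]
  constructor
  · rintro ⟨L, ⟨hL, hs⟩, rfl⟩
    refine ⟨L, hL, ?_⟩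
    rw [hA.eq L hL, mem_affineLine, ← hA.eq L hL]
    linear_combination meetParam_spec hs
  · rintro ⟨L, hL, hmem⟩
    have hmem' := hmem
    rw [hA.eq L hL] at hmem'
    have hs : β L * a - α L * b ≠ 0 := by
      intro hs
      obtain ⟨u, hu, h1, h2, h3⟩ := exists_smul_of_parallel_of_mem h (hA.ne_zero L hL)
        (by linear_combination -hs) hq hmem'
      refine hH ?_
      rw [← affineLine_smul hu a b c, ← h1, ← h2, ← h3, ← hA.eq L hL]
      exact hL
    refine ⟨L, ⟨hL, hs⟩, ?_⟩
    rw [mem_affineLine] at hmem'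
    rw [meetParam, div_eq_iff hs]
    linear_combination -hmem'

open Classical in
theorem nOn_insert {A : Finset (Set (K × K))} {α β γ : Set (K × K) → K}
    (hA : IsEquationSystem A α β γ) {a b c : K} (h : (a, b) ≠ (0, 0))
    (hH : affineLine a b c ∉ A) {p : K × K} (hp : p ∈ affineLine a b c) :
    nOn (insert (affineLine a b c) A) (affineLine a b c) = (meetParams A α β γ a b p).card := by
  have hset : {q : K × K | q ∈ affineLine a b c ∧
      ∃ L ∈ insert (affineLine a b c) A, L ≠ affineLine a b c ∧ q ∈ L} =
      (fun t : K => (p.1 - t * b, p.2 + t * a)) '' (meetParams A α β γ a b p : Set K) := by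
    ext q
    simp only [Set.mem_ofPred_eq, Set.mem_image, Finset.mem_coe, mem_meetParams_iff hA h hH hp]
    constructor
    · rintro ⟨hq, L, hL, hne, hqL⟩
      obtain ⟨t, rfl⟩ := exists_param h hp hq
      exact ⟨t, ⟨L, Finset.mem_of_mem_insert_of_ne hL hne, hqL⟩, rfl⟩
    · rintro ⟨t, ⟨L, hL, hqL⟩, rfl⟩
      refine ⟨?_, L, Finset.mem_insert_of_mem hL, fun he => hH (he ▸ hL), hqL⟩
      rw [mem_affineLine] at hp ⊢
      linear_combination hp
  rw [nOn, hset, Set.ncard_image_of_injective, Set.ncard_coe_finset]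
  intro t t' htt
  simp only [Prod.mk.injEq, sub_right_inj, add_right_inj] at htt
  by_cases ha : a = 0
  · have hb : b ≠ 0 := fun hb => h (by rw [ha, hb])
    exact mul_right_cancel₀ hb htt.1
  · exact mul_right_cancel₀ ha htt.2

end Dimension

section Restriction

theorem restrictLine_lin3_self {a b c : K} {p : K × K} (hp : p ∈ affineLine a b c) :
    restrictLine p (-b, a) (lin3 a b c) = 0 := by
  rw [mem_affineLine] at hp
  rw [restrictLine_lin3, hp, show a * -b + b * a = 0 by ring]
  simp

theorem exists_combination {a b c α β γ α' β' γ' : K} (h : (a, b) ≠ (0, 0)) {p : K × K}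
    (hp : p ∈ affineLine a b c) (hs : β * a - α * b ≠ 0) (hs' : β' * a - α' * b ≠ 0)
    (ht : meetParam a b p α β γ = meetParam a b p α' β' γ') :
    ∃ x y : K, α' = x * α + y * a ∧ β' = x * β + y * b ∧ γ' = x * γ + y * c := by
  have e1 := meetParam_spec (p := p) (γ := γ) hs
  have e2 := meetParam_spec (p := p) (γ := γ') hs'
  rw [← ht] at e2
  rw [mem_affineLine] at hp
  obtain ⟨x, hx⟩ : ∃ x, x * (β * a - α * b) = β' * a - α' * b :=
    ⟨_, div_mul_cancel₀ _ hs⟩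
  obtain ⟨y, h1, h2⟩ := exists_smul_eq_of_mul_eq_mul (a' := α' - x * α) (b' := β' - x * β) h
    (by linear_combination hx)
  refine ⟨x, y, by linear_combination h1, by linear_combination h2, ?_⟩
  linear_combination e2 - x * e1 - y * hp - p.1 * h1 - p.2 * h2 +
    (meetParam a b p α β γ) * hx

/-- Members of a pencil through a common point of `H` all impose conditions along `H`. -/
theorem pow_dvd_restrictLine {A : Finset (Set (K × K))} {α β γ : Set (K × K) → K}
    (hA : IsEquationSystem A α β γ) {a b c : K} (h : (a, b) ≠ (0, 0))
    {p : K × K} (hp : p ∈ affineLine a b c)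
    {η : MvPolynomial (Fin 3) K × MvPolynomial (Fin 3) K} (hη : η ∈ logModule A) (t : K)
    {F : Finset (Set (K × K))} (hF : F ⊆ A) (hFs : ∀ L ∈ F, β L * a - α L * b ≠ 0)
    (hFt : ∀ L ∈ F, meetParam a b p (α L) (β L) (γ L) = t) :
    (Polynomial.X - Polynomial.C t) ^ (F.card - 1) ∣
      restrictLine p (-b, a) (C a * η.1 + C b * η.2) := by
  classical
  rcases F.eq_empty_or_nonempty with rfl | ⟨M, hM⟩
  · simp
  obtain ⟨g, hg⟩ := hη M (hF hM) _ _ _ (hA.ne_zero M (hF hM)) (hA.eq M (hF hM))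
  have hdvd : ∏ L ∈ F.erase M, lin3 (α L) (β L) (γ L) ∣
      (C a * η.1 + C b * η.2) - lin3 a b c * g := by
    refine Finset.prod_dvd_of_isRelPrime (fun L hL L' hL' hne => ?_) fun L hL => ?_
    · have hL := hF (Finset.mem_of_mem_erase hL)
      have hL' := hF (Finset.mem_of_mem_erase hL')
      refine isRelPrime_lin3 (hA.ne_zero L hL) (hA.ne_zero L' hL') ?_
      rwa [← hA.eq L hL, ← hA.eq L' hL']
    · obtain ⟨hne, hL⟩ := Finset.mem_erase.mp hL
      obtain ⟨g', hg'⟩ := hη L (hF hL) _ _ _ (hA.ne_zero L (hF hL)) (hA.eq L (hF hL))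
      obtain ⟨x, y, h1, h2, h3⟩ := exists_combination h hp (hFs M hM) (hFs L hL)
        ((hFt M hM).trans (hFt L hL).symm)
      have hy : y ≠ 0 := by
        rintro rfl
        simp only [zero_mul, add_zero] at h1 h2 h3
        have hx : x ≠ 0 := by
          rintro rfl
          exact hA.ne_zero L (hF hL) (by rw [h1, h2]; simp)
        apply hne
        rw [hA.eq L (hF hL), h1, h2, h3, affineLine_smul hx, ← hA.eq M (hF hM)]
      have hyC : (C y⁻¹ * C y : MvPolynomial (Fin 3) K) = 1 := by
        rw [← C_mul, inv_mul_cancel₀ hy, C_1]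
      refine ⟨C y⁻¹ * (g' - g), ?_⟩
      have hl : lin3 (α L) (β L) (γ L) = C x * lin3 (α M) (β M) (γ M) + C y * lin3 a b c := by
        rw [h1, h2, h3]
        simp only [lin3, C_add, C_mul]
        ring
      rw [h1, h2] at hg'
      simp only [C_add, C_mul] at hg'
      rw [← h1, ← h2] at hg'
      linear_combination (-(C a * η.1 + C b * η.2) + lin3 a b c * g) * hyC + C y⁻¹ * hg' -
        C y⁻¹ * C x * hg + C y⁻¹ * g * hl
  have := map_dvd (restrictLine p (-b, a)) hdvd
  rw [map_sub, map_mul, restrictLine_lin3_self hp, zero_mul, sub_zero, map_prod] at this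
  refine dvd_trans ?_ this
  rw [← Finset.card_erase_of_mem hM, ← Finset.prod_const]
  refine Finset.prod_dvd_prod_of_dvd _ _ fun L hL => ?_
  have hL := Finset.mem_of_mem_erase hL
  rw [restrictLine_lin3_of_ne (hFs L hL), hFt L hL]
  exact dvd_mul_left _ _

theorem natDegree_restrictLine_lt {A : Finset (Set (K × K))} {α β γ : Set (K × K) → K}
    (hA : IsEquationSystem A α β γ) {a b : K} {p : K × K} {k : ℕ}
    {η : MvPolynomial (Fin 3) K × MvPolynomial (Fin 3) K} (hη : η ∈ logDeg A k)
    {F : Finset (Set (K × K))} (hF : F ⊆ A) (hFs : ∀ L ∈ F, β L * a - α L * b = 0) :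
    (restrictLine p (-b, a) (C a * η.1 + C b * η.2)).natDegree < k + 1 - F.card ∨
      restrictLine p (-b, a) (C a * η.1 + C b * η.2) = 0 := by
  classical
  have hE : (C a * η.1 + C b * η.2).IsHomogeneous k :=
    (hη.2.1.C_mul a).add (hη.2.2.C_mul b)
  have hdvd : ∏ L ∈ F, lin3 (α L) (β L) (γ L) ∣ C a * η.1 + C b * η.2 := by
    refine Finset.prod_dvd_of_isRelPrime (fun L hL L' hL' hne => ?_) fun L hL => ?_
    · have hL := hF hL
      have hL' := hF hL'
      refine isRelPrime_lin3 (hA.ne_zero L hL) (hA.ne_zero L' hL') ?_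
      rwa [← hA.eq L hL, ← hA.eq L' hL']
    · have hd := hη.1 L (hF hL) _ _ _ (hA.ne_zero L (hF hL)) (hA.eq L (hF hL))
      obtain ⟨u, h1, h2⟩ := exists_smul_eq_of_mul_eq_mul (hA.ne_zero L (hF hL))
        (a' := a) (b' := b) (by linear_combination hFs L hL)
      have := dvd_mul_of_dvd_right hd (C u)
      convert this using 1
      conv_lhs => rw [h1, h2]
      simp only [C_mul]
      ring
  have hP : (∏ L ∈ F, lin3 (α L) (β L) (γ L)).IsHomogeneous F.card := by
    have := IsHomogeneous.prod F (fun L => lin3 (α L) (β L) (γ L)) (fun _ => 1)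
      fun L _ => lin3_isHomogeneous _ _ _
    simpa using this
  have hP0 : ∏ L ∈ F, lin3 (α L) (β L) (γ L) ≠ 0 :=
    Finset.prod_ne_zero_iff.mpr fun L hL => lin3_ne_zero (hA.ne_zero L (hF hL))
  obtain ⟨G, hG⟩ := hdvd
  rw [hG] at hE ⊢
  rcases lt_or_ge k F.card with hk | hk
  · right
    rw [hP.eq_zero_of_mul_left hE hk, map_zero]
  · left
    obtain ⟨j, rfl⟩ := Nat.exists_eq_add_of_le hk
    have hGj := hP.of_mul_left hP0 hE
    have hc : (restrictLine p (-b, a) (∏ L ∈ F, lin3 (α L) (β L) (γ L))).natDegree = 0 := by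
      rw [map_prod, ← Nat.le_zero]
      refine (Polynomial.natDegree_prod_le _ _).trans (Nat.le_zero.mpr ?_)
      refine Finset.sum_eq_zero fun L hL => ?_
      rw [restrictLine_lin3, show α L * -b + β L * a = 0 by linear_combination hFs L hL,
        Polynomial.C_0, zero_mul, add_zero, Polynomial.natDegree_C]
    rw [map_mul]
    have h1 := Polynomial.natDegree_mul_le
      (p := restrictLine p (-b, a) (∏ L ∈ F, lin3 (α L) (β L) (γ L)))
      (q := restrictLine p (-b, a) G)
    have h2 := natDegree_restrictLine_le p (-b, a) hGj
    omega

open Classical in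
theorem finrank_logDeg_le_insert {A : Finset (Set (K × K))} (hA : IsLineArr A) {a b c : K}
    (h : (a, b) ≠ (0, 0)) (hH : affineLine a b c ∉ A) (k : ℕ) :
    Module.finrank K (logDeg A k) ≤
      Module.finrank K (logDeg (insert (affineLine a b c) A) k) +
        (k + 1 - (A.card - nOn (insert (affineLine a b c) A) (affineLine a b c))) := by
  obtain ⟨α, β, γ, hE⟩ := hA.exists_isEquationSystem
  obtain ⟨p, hp⟩ := affineLine_nonempty h c
  have hp : p ∈ affineLine a b c := hp
  rw [nOn_insert hE h hH hp]
  set T := meetParams A α β γ a b p with hT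
  set N := A.filter fun L => β L * a - α L * b ≠ 0 with hN
  set P := A.filter fun L => ¬ (β L * a - α L * b ≠ 0) with hP
  have hcard : N.card + P.card = A.card := Finset.card_filter_add_card_filter_not _
  let F : K → Finset (Set (K × K)) := fun t =>
    N.filter fun L => meetParam a b p (α L) (β L) (γ L) = t
  have hFcard : ∑ t ∈ T, (F t).card = N.card :=
    (Finset.card_eq_sum_card_fiberwise fun L hL => Finset.mem_image_of_mem _ hL).symm
  have hFpos : ∀ t ∈ T, 1 ≤ (F t).card := by
    intro t ht
    obtain ⟨L, hL, hLt⟩ := Finset.mem_image.mp ht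
    exact Finset.card_pos.mpr ⟨L, Finset.mem_filter.mpr ⟨hL, hLt⟩⟩
  let Q : Polynomial K := ∏ t ∈ T, (Polynomial.X - Polynomial.C t) ^ ((F t).card - 1)
  have hQ : Q.natDegree = N.card - T.card := by
    rw [Polynomial.natDegree_prod_of_monic _ _ fun t _ => (Polynomial.monic_X_sub_C t).pow _]
    simp only [Polynomial.natDegree_pow, Polynomial.natDegree_X_sub_C, mul_one]
    rw [← hFcard, Finset.sum_tsub_distrib _ hFpos]
    simp
  have hTN : T.card ≤ N.card := Finset.card_image_le
  let f : (MvPolynomial (Fin 3) K × MvPolynomial (Fin 3) K) →ₗ[K] Polynomial K :=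
    (restrictLine p (-b, a)).toLinearMap ∘ₗ
      (a • LinearMap.fst K _ _ + b • LinearMap.snd K _ _)
  have hf : ∀ η, f η = restrictLine p (-b, a) (C a * η.1 + C b * η.2) := fun η => by
    simp [f, MvPolynomial.smul_eq_C_mul]
  have key := finrank_le_finrank_add f (logDeg A k) (logDeg (insert (affineLine a b c) A) k)
    ((Polynomial.degreeLT K (k + 1 - P.card - Q.natDegree)).map (LinearMap.mulLeft K Q))
    (fun η hη => ?_) (fun η hη h0 => ?_)
  · refine key.trans (Nat.add_le_add_left
      ((finrank_map_mulLeft_degreeLT_le _ _).trans ?_) _)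
    rw [hQ]
    omega
  · rw [hf]
    refine mem_map_mulLeft_degreeLT (natDegree_restrictLine_lt hE hη
      (Finset.filter_subset _ _) fun L hL => not_not.mp (Finset.mem_filter.mp hL).2) ?_
    refine Finset.prod_dvd_of_isRelPrime (fun t _ t' _ hne => ?_) fun t ht => ?_
    · exact (IsCoprime.pow (Polynomial.pairwise_coprime_X_sub_C
        Function.injective_id hne)).isRelPrime
    · refine pow_dvd_restrictLine hE h hp hη.1 t
        ((Finset.filter_subset _ _).trans (Finset.filter_subset _ _)) (fun L hL => ?_)
        fun L hL => (Finset.mem_filter.mp hL).2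
      exact (Finset.mem_filter.mp (Finset.mem_filter.mp hL).1).2
  · rw [hf] at h0
    exact ⟨(mem_logModule_insert h).mpr ⟨hη.1, lin3_dvd_of_restrictLine_eq_zero h hp
      ((hη.2.1.C_mul a).add (hη.2.2.C_mul b)) h0⟩, hη.2⟩

end Restriction

section Extension

theorem restrictLine_eq_of_mem {a b c e₁ e₂ : K} (he : e₂ * a - e₁ * b = 1)
    {p : K × K} (hp : p ∈ affineLine a b c)
    {η : MvPolynomial (Fin 3) K × MvPolynomial (Fin 3) K}
    (hd : lin3 a b c ∣ C a * η.1 + C b * η.2) :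
    restrictLine p (-b, a) η.1 =
        -Polynomial.C b * restrictLine p (-b, a) (C e₁ * η.1 + C e₂ * η.2) ∧
      restrictLine p (-b, a) η.2 =
        Polynomial.C a * restrictLine p (-b, a) (C e₁ * η.1 + C e₂ * η.2) := by
  obtain ⟨g, hg⟩ := hd
  have h := congrArg (restrictLine p (-b, a)) hg
  have hC : ∀ u : K, restrictLine p (-b, a) (C u) = Polynomial.C u := fun u => by
    simp [restrictLine]
  rw [map_mul, restrictLine_lin3_self hp, zero_mul] at h
  simp only [map_add, map_mul, hC] at h ⊢
  have heC : (Polynomial.C e₂ * Polynomial.C a - Polynomial.C e₁ * Polynomial.C b) = 1 := by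
    rw [← Polynomial.C_mul, ← Polynomial.C_mul, ← Polynomial.C_sub, he, Polynomial.C_1]
  constructor
  · linear_combination Polynomial.C e₂ * h - restrictLine p (-b, a) η.1 * heC
  · linear_combination -Polynomial.C e₁ * h - restrictLine p (-b, a) η.2 * heC

open Classical in
/-- Division by the equation of `H` is compatible with the logarithmic condition. -/
theorem mem_logModule_of_smul {A : Finset (Set (K × K))} {a b c : K} (h : (a, b) ≠ (0, 0))
    (hH : affineLine a b c ∉ A) {η : MvPolynomial (Fin 3) K × MvPolynomial (Fin 3) K}
    (hη : lin3 a b c • η ∈ logModule A) : η ∈ logModule A := by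
  intro L hL α β γ hl he
  have hd := hη L hL α β γ hl he
  simp only [Prod.smul_fst, Prod.smul_snd, smul_eq_mul] at hd
  have hd' : lin3 α β γ ∣ lin3 a b c * (C α * η.1 + C β * η.2) := by
    convert hd using 1; ring
  refine ((lin3_prime hl).dvd_or_dvd hd').resolve_left fun hdvd => hH ?_
  rw [← affineLine_eq_of_lin3_dvd h hdvd, ← he]
  exact hL

open Classical in
theorem finrank_logDeg_insert_le_aux {A : Finset (Set (K × K))} (hA : IsLineArr A) {a b c : K}
    (h : (a, b) ≠ (0, 0)) (hH : affineLine a b c ∉ A) (m : ℕ)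
    (P : Submodule K (MvPolynomial (Fin 3) K × MvPolynomial (Fin 3) K)) [Module.Finite K P]
    (hP : ∀ η : MvPolynomial (Fin 3) K × MvPolynomial (Fin 3) K, η ∈ logModule A →
      (lin3 a b c * η.1).IsHomogeneous m → (lin3 a b c * η.2).IsHomogeneous m →
      lin3 a b c • η ∈ P) :
    Module.finrank K (logDeg (insert (affineLine a b c) A) m) ≤ Module.finrank K P +
      (m + 1 - nOn (insert (affineLine a b c) A) (affineLine a b c)) := by
  obtain ⟨α, β, γ, hE⟩ := hA.exists_isEquationSystem
  obtain ⟨p, hp⟩ := affineLine_nonempty h c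
  have hp : p ∈ affineLine a b c := hp
  obtain ⟨e₁, e₂, he⟩ := exists_dual h
  rw [nOn_insert hE h hH hp]
  set T := meetParams A α β γ a b p with hT
  let Q : Polynomial K := ∏ t ∈ T, (Polynomial.X - Polynomial.C t)
  have hQ : Q.natDegree = T.card := by
    rw [Polynomial.natDegree_prod_of_monic _ _ fun t _ => Polynomial.monic_X_sub_C t]
    simp
  let f : (MvPolynomial (Fin 3) K × MvPolynomial (Fin 3) K) →ₗ[K] Polynomial K :=
    (restrictLine p (-b, a)).toLinearMap ∘ₗ
      (e₁ • LinearMap.fst K _ _ + e₂ • LinearMap.snd K _ _)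
  have hf : ∀ η, f η = restrictLine p (-b, a) (C e₁ * η.1 + C e₂ * η.2) := fun η => by
    simp [f, MvPolynomial.smul_eq_C_mul]
  have key := finrank_le_finrank_add f (logDeg (insert (affineLine a b c) A) m) P
    ((Polynomial.degreeLT K (m + 1 - Q.natDegree)).map (LinearMap.mulLeft K Q))
    (fun η hη => ?_) (fun η hη h0 => ?_)
  · refine key.trans (Nat.add_le_add_left
      ((finrank_map_mulLeft_degreeLT_le _ _).trans ?_) _)
    rw [hQ]
  · rw [hf]
    obtain ⟨hηA, hηH⟩ := (mem_logModule_insert h).mp hη.1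
    obtain ⟨r1, r2⟩ := restrictLine_eq_of_mem he hp hηH
    refine mem_map_mulLeft_degreeLT (Or.inl (Nat.lt_succ_of_le
      (natDegree_restrictLine_le _ _ ((hη.2.1.C_mul e₁).add (hη.2.2.C_mul e₂))))) ?_
    refine Finset.prod_dvd_of_isRelPrime (fun t _ t' _ hne => ?_) fun t ht => ?_
    · exact (Polynomial.pairwise_coprime_X_sub_C Function.injective_id hne).isRelPrime
    · obtain ⟨L, hL, hLt⟩ := Finset.mem_image.mp ht
      obtain ⟨hL, hs⟩ := Finset.mem_filter.mp hL
      obtain ⟨g, hg⟩ := hηA L hL _ _ _ (hE.ne_zero L hL) (hE.eq L hL)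
      have hg := congrArg (restrictLine p (-b, a)) hg
      have hC : ∀ u : K, restrictLine p (-b, a) (C u) = Polynomial.C u := fun u => by
        simp [restrictLine]
      rw [map_mul, restrictLine_lin3_of_ne hs, hLt, map_add, map_mul, map_mul, hC, hC, r1,
        r2] at hg
      have hu : Polynomial.C (β L * a - α L * b)⁻¹ * Polynomial.C (β L * a - α L * b) = 1 := by
        rw [← Polynomial.C_mul, inv_mul_cancel₀ hs, Polynomial.C_1]
      refine ⟨restrictLine p (-b, a) g, mul_left_cancel₀
        (Polynomial.C_ne_zero.mpr hs) ?_⟩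
      rw [← mul_assoc, ← hg]
      simp only [Polynomial.C_sub, Polynomial.C_mul]
      ring
  · rw [hf] at h0
    obtain ⟨hηA, hηH⟩ := (mem_logModule_insert h).mp hη.1
    obtain ⟨r1, r2⟩ := restrictLine_eq_of_mem he hp hηH
    rw [h0, mul_zero] at r1 r2
    obtain ⟨g1, hg1⟩ := lin3_dvd_of_restrictLine_eq_zero h hp hη.2.1 r1
    obtain ⟨g2, hg2⟩ := lin3_dvd_of_restrictLine_eq_zero h hp hη.2.2 r2
    have hη' : η = lin3 a b c • (g1, g2) := Prod.ext hg1 hg2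
    rw [hη']
    refine hP _ (mem_logModule_of_smul h hH (hη' ▸ hηA)) ?_ ?_
    · exact hg1 ▸ hη.2.1
    · exact hg2 ▸ hη.2.2

open Classical in
theorem finrank_logDeg_insert_succ_le {A : Finset (Set (K × K))} (hA : IsLineArr A) {a b c : K}
    (h : (a, b) ≠ (0, 0)) (hH : affineLine a b c ∉ A) (k : ℕ) :
    Module.finrank K (logDeg (insert (affineLine a b c) A) (k + 1)) ≤
      Module.finrank K (logDeg A k) +
        (k + 2 - nOn (insert (affineLine a b c) A) (affineLine a b c)) := by
  let f := LinearMap.lsmul (MvPolynomial (Fin 3) K)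
    (MvPolynomial (Fin 3) K × MvPolynomial (Fin 3) K) (lin3 a b c)
  refine (finrank_logDeg_insert_le_aux hA h hH (k + 1)
    ((logDeg A k).map (f.restrictScalars K)) fun η hη h1 h2 => ?_).trans
    (Nat.add_le_add_right (Submodule.finrank_map_le _ _) _)
  rw [add_comm] at h1 h2
  exact ⟨η, ⟨hη, (lin3_isHomogeneous a b c).of_mul_left (lin3_ne_zero h) h1,
    (lin3_isHomogeneous a b c).of_mul_left (lin3_ne_zero h) h2⟩, rfl⟩

open Classical in
theorem finrank_logDeg_insert_zero_le {A : Finset (Set (K × K))} (hA : IsLineArr A) {a b c : K}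
    (h : (a, b) ≠ (0, 0)) (hH : affineLine a b c ∉ A) :
    Module.finrank K (logDeg (insert (affineLine a b c) A) 0) ≤
      1 - nOn (insert (affineLine a b c) A) (affineLine a b c) := by
  refine (finrank_logDeg_insert_le_aux hA h hH 0 ⊥ fun η hη h1 h2 => ?_).trans (by simp)
  have e1 := (lin3_isHomogeneous a b c).eq_zero_of_mul_left h1 zero_lt_one
  have e2 := (lin3_isHomogeneous a b c).eq_zero_of_mul_left h2 zero_lt_one
  rw [Submodule.mem_bot]
  exact Prod.ext e1 e2

end Extension

section BettiRecursion

theorem mem_affineLine_param {a b c : K} {p : K × K} (hp : p ∈ affineLine a b c) (t : K) :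
    (p.1 - t * b, p.2 + t * a) ∈ affineLine a b c := by
  rw [mem_affineLine] at hp ⊢
  linear_combination hp

theorem param_unique {a b c : K} (h : (a, b) ≠ (0, 0)) {p : K × K} (hp : p ∈ affineLine a b c)
    {L : Set (K × K)} (hL : IsAffineLine L) (hne : L ≠ affineLine a b c) {t t' : K}
    (ht : (p.1 - t * b, p.2 + t * a) ∈ L) (ht' : (p.1 - t' * b, p.2 + t' * a) ∈ L) :
    t = t' := by
  obtain ⟨α, β, γ, hl, he⟩ := hL
  change L = affineLine α β γ at he
  rw [he] at ht ht'
  by_contra hn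
  refine hne ?_
  have hm := ht
  rw [mem_affineLine] at ht ht'
  have h0 : (t - t') * (β * a - α * b) = 0 := by linear_combination ht - ht'
  have hs := (mul_eq_zero.mp h0).resolve_left (sub_ne_zero.mpr hn)
  obtain ⟨u, hu, h1, h2, h3⟩ := exists_smul_of_parallel_of_mem h hl
    (by linear_combination -hs) (mem_affineLine_param hp t) hm
  rw [he, h1, h2, h3, affineLine_smul hu]

open Classical in
theorem b2_insert {A : Finset (Set (K × K))} (hA : IsLineArr A) {a b c : K}
    (h : (a, b) ≠ (0, 0)) (hH : affineLine a b c ∉ A) :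
    b2 (insert (affineLine a b c) A) =
      b2 A + nOn (insert (affineLine a b c) A) (affineLine a b c) := by
  obtain ⟨α, β, γ, hE⟩ := hA.exists_isEquationSystem
  obtain ⟨p, hp⟩ := affineLine_nonempty h c
  have hp : p ∈ affineLine a b c := hp
  rw [nOn_insert hE h hH hp]
  set T := meetParams A α β γ a b p with hT
  let F : K → Finset (Set (K × K)) := fun t =>
    A.filter fun L => (p.1 - t * b, p.2 + t * a) ∈ L
  have hF : ∀ t ∈ T, (F t).Nonempty := fun t ht => by
    obtain ⟨L, hL, hm⟩ := (mem_meetParams_iff hE h hH hp t).mp ht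
    exact ⟨L, Finset.mem_filter.mpr ⟨hL, hm⟩⟩
  rw [b2, Finset.sum_filter, Finset.sum_powerset_insert hH, ← Finset.sum_filter, ← b2]
  congr 1
  have key : ∀ D ∈ A.powerset,
      (if 2 ≤ (insert (affineLine a b c) D).card ∧
          (⋂ L ∈ insert (affineLine a b c) D, (L : Set (K × K))).Nonempty
        then (-1 : ℤ) ^ (insert (affineLine a b c) D).card else 0) =
      ∑ t ∈ T, if D ∈ (F t).powerset then (if D = ∅ then 0 else -(-1 : ℤ) ^ D.card) else 0 := by
    intro D hD
    rw [Finset.mem_powerset] at hD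
    have hHD : affineLine a b c ∉ D := fun hh => hH (hD hh)
    rw [Finset.card_insert_of_notMem hHD]
    rcases D.eq_empty_or_nonempty with rfl | ⟨M, hM⟩
    · simp
    have hD0 : D ≠ ∅ := Finset.ne_empty_of_mem hM
    have hDc : 2 ≤ D.card + 1 := by
      have := Finset.card_pos.mpr ⟨M, hM⟩
      omega
    have huniq : ∀ {t t'}, D ⊆ F t → D ⊆ F t' → t = t' := fun ht ht' =>
      param_unique h hp (hA M (hD hM)) (fun he => hHD (he ▸ hM))
        (Finset.mem_filter.mp (ht hM)).2 (Finset.mem_filter.mp (ht' hM)).2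
    simp only [hDc, true_and, hD0, if_false, Finset.mem_powerset]
    by_cases hne : (⋂ L ∈ insert (affineLine a b c) D, (L : Set (K × K))).Nonempty
    · rw [if_pos hne]
      obtain ⟨q, hq⟩ := hne
      simp only [Set.mem_iInter] at hq
      obtain ⟨t, rfl⟩ := exists_param h hp (hq _ (Finset.mem_insert_self _ _))
      have hDt : D ⊆ F t := fun L hL =>
        Finset.mem_filter.mpr ⟨hD hL, hq L (Finset.mem_insert_of_mem hL)⟩
      have htT : t ∈ T := (mem_meetParams_iff hE h hH hp t).mpr
        ⟨M, hD hM, hq M (Finset.mem_insert_of_mem hM)⟩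
      rw [Finset.sum_eq_single_of_mem t htT fun t' _ ht' =>
        if_neg fun hs => ht' (huniq hs hDt), if_pos hDt]
      ring
    · rw [if_neg hne]
      refine (Finset.sum_eq_zero fun t _ => if_neg fun hs => hne ?_).symm
      refine ⟨(p.1 - t * b, p.2 + t * a), ?_⟩
      simp only [Set.mem_iInter]
      intro L hL
      rcases Finset.mem_insert.mp hL with rfl | hL
      · exact mem_affineLine_param hp t
      · exact (Finset.mem_filter.mp (hs hL)).2
  rw [Finset.sum_congr rfl key, Finset.sum_comm]
  have hone : ∀ t ∈ T, (∑ D ∈ A.powerset, if D ∈ (F t).powerset then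
      (if D = ∅ then 0 else -(-1 : ℤ) ^ D.card) else 0) = 1 := by
    intro t ht
    rw [← Finset.sum_filter, Finset.filter_mem_eq_inter, Finset.inter_eq_right.mpr
      (Finset.powerset_mono.mpr (Finset.filter_subset _ _))]
    have hs : ∀ D ∈ (F t).powerset, (if D = ∅ then 0 else -(-1 : ℤ) ^ D.card) =
        (if D = ∅ then 1 else 0) - (-1 : ℤ) ^ D.card := by
      intro D _
      split_ifs with hD
      · simp [hD]
      · simp
    rw [Finset.sum_congr rfl hs, Finset.sum_sub_distrib,
      Finset.sum_powerset_neg_one_pow_card_of_nonempty (hF t ht), sub_zero,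
      Finset.sum_ite_eq' , if_pos (Finset.empty_mem_powerset _)]
  rw [Finset.sum_congr rfl hone]
  simp

theorem b2_empty : b2 (∅ : Finset (Set (K × K))) = 0 := by
  simp [b2, Finset.filter_singleton]

theorem two_mul_choose_two (k : ℕ) : (2 : ℤ) * (k + 2).choose 2 = (k + 2) * (k + 1) := by
  have := Nat.add_one_mul_choose_eq (k + 1) 1
  rw [Nat.choose_one_right] at this
  zify at this
  linear_combination -this

/-- The dimension of the homogeneous parts of `logModule A` in large degrees. -/
theorem two_mul_finrank_logDeg {A : Finset (Set (K × K))} (hA : IsLineArr A) {k : ℕ}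
    (hk : A.card ≤ k) :
    2 * (Module.finrank K (logDeg A k) : ℤ) =
      2 * (k + 2) * (k + 1) - 2 * A.card * (k + 1) + A.card * (A.card - 1) - 2 * b2 A := by
  classical
  induction A using Finset.induction_on generalizing k with
  | empty =>
    rw [finrank_logDeg_empty, b2_empty, Finset.card_empty]
    push_cast
    linear_combination 2 * two_mul_choose_two k
  | insert H A hH ih =>
    obtain ⟨a, b, c, h, he⟩ := hA H (Finset.mem_insert_self _ _)
    change H = affineLine a b c at he
    subst he
    have hA' : IsLineArr A := fun L hL => hA L (Finset.mem_insert_of_mem hL)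
    rw [Finset.card_insert_of_notMem hH] at hk ⊢
    obtain ⟨j, rfl⟩ : ∃ j, k = j + 1 := ⟨k - 1, by omega⟩
    have h1 := finrank_logDeg_le_insert hA' h hH (j + 1)
    have h2 := finrank_logDeg_insert_succ_le hA' h hH j
    have h3 : nOn (insert (affineLine a b c) A) (affineLine a b c) ≤ A.card := by
      obtain ⟨α, β, γ, hE⟩ := hA'.exists_isEquationSystem
      obtain ⟨p, hp⟩ := affineLine_nonempty h c
      rw [nOn_insert hE h hH hp]
      exact Finset.card_image_le.trans (Finset.card_filter_le _ _)
    have i1 := ih hA' (k := j + 1) (by omega)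
    have i2 := ih hA' (k := j) (by omega)
    rw [b2_insert hA' h hH]
    generalize nOn (insert (affineLine a b c) A) (affineLine a b c) = m at *
    zify [show A.card - m ≤ j + 1 + 1 by omega, h3] at h1
    zify [show m ≤ j + 2 by omega] at h2
    push_cast at *
    apply le_antisymm <;> nlinarith

end BettiRecursion

section LogBasis

/-- The determinant of the coefficients of two planar derivations. -/
noncomputable def pairDet (η ξ : MvPolynomial (Fin 3) K × MvPolynomial (Fin 3) K) :
    MvPolynomial (Fin 3) K := η.1 * ξ.2 - η.2 * ξ.1

/-- `η₁, η₂` form a homogeneous basis of `logModule A` of degrees `d₁, d₂`. -/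
structure IsLogBasis (A : Finset (Set (K × K))) (d₁ d₂ : ℕ)
    (η₁ η₂ : MvPolynomial (Fin 3) K × MvPolynomial (Fin 3) K) : Prop where
  mem₁ : η₁ ∈ logDeg A d₁
  mem₂ : η₂ ∈ logDeg A d₂
  det_ne_zero : pairDet η₁ η₂ ≠ 0
  span : ∀ η ∈ logModule A, ∃ f g : MvPolynomial (Fin 3) K, η = f • η₁ + g • η₂

theorem eq_zero_of_smul_add_smul_eq_zero
    {η ξ : MvPolynomial (Fin 3) K × MvPolynomial (Fin 3) K} (h : pairDet η ξ ≠ 0)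
    {f g : MvPolynomial (Fin 3) K} (h0 : f • η + g • ξ = 0) : f = 0 ∧ g = 0 := by
  have h1 := congrArg Prod.fst h0
  have h2 := congrArg Prod.snd h0
  simp only [Prod.fst_add, Prod.snd_add, Prod.smul_fst, Prod.smul_snd, smul_eq_mul,
    Prod.fst_zero, Prod.snd_zero] at h1 h2
  constructor
  · refine (mul_eq_zero.mp (?_ : f * pairDet η ξ = 0)).resolve_right h
    rw [pairDet]
    linear_combination ξ.2 * h1 - ξ.1 * h2
  · refine (mul_eq_zero.mp (?_ : g * pairDet η ξ = 0)).resolve_right h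
    rw [pairDet]
    linear_combination η.1 * h2 - η.2 * h1

theorem pairDet_ne_zero_of_forall {η ξ : MvPolynomial (Fin 3) K × MvPolynomial (Fin 3) K}
    (h : ∀ f g : MvPolynomial (Fin 3) K, f • η + g • ξ = 0 → f = 0 ∧ g = 0) :
    pairDet η ξ ≠ 0 := by
  intro h0
  rw [pairDet] at h0
  have h1 := h ξ.2 (-η.2) (Prod.ext (by
    simp only [Prod.fst_add, Prod.smul_fst, smul_eq_mul, Prod.fst_zero]
    linear_combination h0) (by
    simp only [Prod.snd_add, Prod.smul_snd, smul_eq_mul, Prod.snd_zero]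
    ring))
  have h2 := h ξ.1 (-η.1) (Prod.ext (by
    simp only [Prod.fst_add, Prod.smul_fst, smul_eq_mul, Prod.fst_zero]
    ring) (by
    simp only [Prod.snd_add, Prod.smul_snd, smul_eq_mul, Prod.snd_zero]
    linear_combination -h0))
  refine one_ne_zero (h 1 0 ?_).1
  rw [one_smul, zero_smul, add_zero]
  exact Prod.ext (neg_eq_zero.mp h2.2) (neg_eq_zero.mp h1.2)

theorem applyDer3_lin3 (θ : Fin 3 → MvPolynomial (Fin 3) K) (a b c : K) :
    applyDer3 θ (lin3 a b c) = C a * θ 0 + C b * θ 1 + C c * θ 2 := by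
  simp [applyDer3, lin3, Fin.sum_univ_three, pderiv_X, Pi.single_apply]
  ring

theorem applyDer3_X_two (θ : Fin 3 → MvPolynomial (Fin 3) K) : applyDer3 θ (X 2) = θ 2 := by
  simp [applyDer3, pderiv_X, Pi.single_apply]

theorem sub_smul_mem_logModule {A : Finset (Set (K × K))} {θ : Fin 3 → MvPolynomial (Fin 3) K}
    (hθ : InDCone A θ) {g : MvPolynomial (Fin 3) K} (hg : θ 2 = g * X 2) :
    (θ 0 - g * X 0, θ 1 - g * X 1) ∈ logModule A := by
  intro L hL a b c h he
  obtain ⟨u, hu⟩ := hθ.1 L hL a b c h he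
  rw [applyDer3_lin3, hg] at hu
  refine ⟨u - g, ?_⟩
  simp only [lin3] at hu ⊢
  linear_combination hu

theorem inDCone_of_mem_logModule {A : Finset (Set (K × K))}
    {η : MvPolynomial (Fin 3) K × MvPolynomial (Fin 3) K} (hη : η ∈ logModule A) :
    InDCone A ![η.1, η.2, 0] := by
  refine ⟨fun L hL a b c h he => ?_, 0, ?_⟩
  · obtain ⟨u, hu⟩ := hη L hL a b c h he
    refine ⟨u, ?_⟩
    rw [applyDer3_lin3]
    simp only [Matrix.cons_val]
    linear_combination hu
  · rw [applyDer3_X_two]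
    simp

theorem isHomogeneous_sub_mul_X {θ : Fin 3 → MvPolynomial (Fin 3) K} {d : ℕ}
    (hθ : HomogDer3 θ d) {g : MvPolynomial (Fin 3) K} (hg : θ 2 = g * X 2) (i : Fin 3) :
    (θ i - g * X i).IsHomogeneous d := by
  refine (hθ i).sub ?_
  have h2 := hθ 2
  rw [hg, mul_comm] at h2
  rcases d with _ | d
  · have h0 := (isHomogeneous_X K (2 : Fin 3)).eq_zero_of_mul_left h2 zero_lt_one
    rw [(mul_eq_zero.mp h0).resolve_left (X_ne_zero 2), zero_mul]
    exact isHomogeneous_zero _ _ _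
  · rw [add_comm] at h2
    exact ((isHomogeneous_X K (2 : Fin 3)).of_mul_left (X_ne_zero 2) h2).mul (isHomogeneous_X K i)

theorem IsFreeExp.exists_isLogBasis {A : Finset (Set (K × K))} {d₁ d₂ : ℕ}
    (h : IsFreeExp A d₁ d₂) : ∃ η₁ η₂, IsLogBasis A d₁ d₂ η₁ η₂ := by
  obtain ⟨θ₁, θ₂, h1, h2, hd1, hd2, hu⟩ := h
  obtain ⟨g₁, hg1⟩ := h1.2
  obtain ⟨g₂, hg2⟩ := h2.2
  rw [applyDer3_X_two] at hg1 hg2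
  refine ⟨(θ₁ 0 - g₁ * X 0, θ₁ 1 - g₁ * X 1), (θ₂ 0 - g₂ * X 0, θ₂ 1 - g₂ * X 1),
    ⟨sub_smul_mem_logModule h1 hg1, isHomogeneous_sub_mul_X hd1 hg1 0,
      isHomogeneous_sub_mul_X hd1 hg1 1⟩,
    ⟨sub_smul_mem_logModule h2 hg2, isHomogeneous_sub_mul_X hd2 hg2 0,
      isHomogeneous_sub_mul_X hd2 hg2 1⟩, pairDet_ne_zero_of_forall fun f g h0 => ?_,
    fun η hη => ?_⟩
  · have e1 := congrArg Prod.fst h0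
    have e2 := congrArg Prod.snd h0
    simp only [Prod.fst_add, Prod.snd_add, Prod.smul_fst, Prod.smul_snd, smul_eq_mul,
      Prod.fst_zero, Prod.snd_zero] at e1 e2
    obtain ⟨cfs, -, huniq⟩ := hu 0 (by
      refine ⟨fun L hL a b c _ _ => ⟨0, ?_⟩, 0, ?_⟩ <;> simp [applyDer3])
    have u1 := huniq (0, 0, 0) (by funext j; simp)
    have u2 := huniq (-(f * g₁ + g * g₂), f, g) (by
      funext j
      fin_cases j
      · simp only [Fin.zero_eta, Pi.zero_apply]
        linear_combination -e1
      · simp only [Fin.mk_one, Pi.zero_apply]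
        linear_combination -e2
      · simp only [Fin.reduceFinMk, Pi.zero_apply, hg1, hg2]
        ring)
    rw [← u1] at u2
    simp only [Prod.mk.injEq] at u2
    exact u2.2
  · obtain ⟨⟨f, f₁, f₂⟩, he, -⟩ := hu _ (inDCone_of_mem_logModule hη)
    have e0 := congrFun he 0
    have e1 := congrFun he 1
    have e2 := congrFun he 2
    simp only [Matrix.cons_val, hg1, hg2] at e0 e1 e2
    have e3 : f + f₁ * g₁ + f₂ * g₂ = 0 :=
      (mul_eq_zero.mp (by linear_combination -e2 :
        (f + f₁ * g₁ + f₂ * g₂) * (X 2 : MvPolynomial (Fin 3) K) = 0)).resolve_right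
        (X_ne_zero 2)
    refine ⟨f₁, f₂, Prod.ext ?_ ?_⟩
    · simp only [Prod.fst_add, Prod.smul_fst, smul_eq_mul]
      linear_combination e0 + X 0 * e3
    · simp only [Prod.snd_add, Prod.smul_snd, smul_eq_mul]
      linear_combination e1 + X 1 * e3

theorem IsLogBasis.isFreeExp {A : Finset (Set (K × K))} {d₁ d₂ : ℕ}
    {η₁ η₂ : MvPolynomial (Fin 3) K × MvPolynomial (Fin 3) K} (h : IsLogBasis A d₁ d₂ η₁ η₂) :
    IsFreeExp A d₁ d₂ := by
  refine ⟨![η₁.1, η₁.2, 0], ![η₂.1, η₂.2, 0], inDCone_of_mem_logModule h.mem₁.1,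
    inDCone_of_mem_logModule h.mem₂.1, fun i => ?_, fun i => ?_, fun θ hθ => ?_⟩
  · fin_cases i
    exacts [h.mem₁.2.1, h.mem₁.2.2, isHomogeneous_zero _ _ _]
  · fin_cases i
    exacts [h.mem₂.2.1, h.mem₂.2.2, isHomogeneous_zero _ _ _]
  · obtain ⟨g, hg⟩ := hθ.2
    rw [applyDer3_X_two] at hg
    obtain ⟨f₁, f₂, hf⟩ := h.span _ (sub_smul_mem_logModule hθ hg)
    have e1 := congrArg Prod.fst hf
    have e2 := congrArg Prod.snd hf
    simp only [Prod.fst_add, Prod.snd_add, Prod.smul_fst, Prod.smul_snd, smul_eq_mul] at e1 e2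
    refine ⟨(g, f₁, f₂), ?_, ?_⟩
    · funext j
      fin_cases j
      · simp only [Fin.zero_eta, Matrix.cons_val]
        linear_combination e1
      · simp only [Fin.mk_one, Matrix.cons_val]
        linear_combination e2
      · simp only [Fin.reduceFinMk, Matrix.cons_val]
        linear_combination hg
    · rintro ⟨g', f₁', f₂'⟩ he
      have c0 := congrFun he 0
      have c1 := congrFun he 1
      have c2 := congrFun he 2
      simp only [Matrix.cons_val] at c0 c1 c2
      have hgg : g' = g := mul_right_cancel₀ (X_ne_zero (R := K) (2 : Fin 3))
        (by linear_combination hg - c2)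
      subst hgg
      obtain ⟨z1, z2⟩ := eq_zero_of_smul_add_smul_eq_zero h.det_ne_zero
        (f := f₁' - f₁) (g := f₂' - f₂) (Prod.ext (by
          simp only [Prod.fst_add, Prod.smul_fst, smul_eq_mul, Prod.fst_zero]
          linear_combination e1 - c0) (by
          simp only [Prod.snd_add, Prod.smul_snd, smul_eq_mul, Prod.snd_zero]
          linear_combination e2 - c1))
      rw [sub_eq_zero.mp z1, sub_eq_zero.mp z2]

theorem lin3_dvd_pairDet {a b c : K} (h : (a, b) ≠ (0, 0))
    {η ξ : MvPolynomial (Fin 3) K × MvPolynomial (Fin 3) K}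
    (hη : lin3 a b c ∣ C a * η.1 + C b * η.2) (hξ : lin3 a b c ∣ C a * ξ.1 + C b * ξ.2) :
    lin3 a b c ∣ pairDet η ξ := by
  obtain ⟨e₁, e₂, he⟩ := exists_dual h
  have heC : (C e₂ * C a - C e₁ * C b : MvPolynomial (Fin 3) K) = 1 := by
    rw [← C_mul, ← C_mul, ← C_sub, he, C_1]
  obtain ⟨u, hu⟩ := hη
  obtain ⟨v, hv⟩ := hξ
  refine ⟨C e₂ * (u * ξ.2 - η.2 * v) - C e₁ * (η.1 * v - u * ξ.1), ?_⟩
  rw [pairDet]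
  linear_combination -(η.1 * ξ.2 - η.2 * ξ.1) * heC + (C e₂ * ξ.2 + C e₁ * ξ.1) * hu -
    (C e₂ * η.2 + C e₁ * η.1) * hv

theorem IsEquationSystem.prod_dvd_pairDet {A : Finset (Set (K × K))} {α β γ : Set (K × K) → K}
    (hA : IsEquationSystem A α β γ) {η ξ : MvPolynomial (Fin 3) K × MvPolynomial (Fin 3) K}
    (hη : η ∈ logModule A) (hξ : ξ ∈ logModule A) :
    ∏ L ∈ A, lin3 (α L) (β L) (γ L) ∣ pairDet η ξ := by
  refine Finset.prod_dvd_of_isRelPrime (fun L hL L' hL' hne => ?_) fun L hL => ?_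
  · refine isRelPrime_lin3 (hA.ne_zero L hL) (hA.ne_zero L' hL') ?_
    rwa [← hA.eq L hL, ← hA.eq L' hL']
  · exact lin3_dvd_pairDet (hA.ne_zero L hL) (hη L hL _ _ _ (hA.ne_zero L hL) (hA.eq L hL))
      (hξ L hL _ _ _ (hA.ne_zero L hL) (hA.eq L hL))

theorem pairDet_isHomogeneous {A : Finset (Set (K × K))} {d₁ d₂ : ℕ}
    {η ξ : MvPolynomial (Fin 3) K × MvPolynomial (Fin 3) K} (hη : η ∈ logDeg A d₁)
    (hξ : ξ ∈ logDeg A d₂) : (pairDet η ξ).IsHomogeneous (d₁ + d₂) :=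
  (hη.2.1.mul hξ.2.2).sub (hη.2.2.mul hξ.2.1)

/-- Saito's criterion. -/
theorem isLogBasis_of_pairDet_ne_zero {A : Finset (Set (K × K))} (hA : IsLineArr A) {d₁ d₂ : ℕ}
    {η₁ η₂ : MvPolynomial (Fin 3) K × MvPolynomial (Fin 3) K} (h₁ : η₁ ∈ logDeg A d₁)
    (h₂ : η₂ ∈ logDeg A d₂) (hd : pairDet η₁ η₂ ≠ 0) (hcard : d₁ + d₂ = A.card) :
    IsLogBasis A d₁ d₂ η₁ η₂ := by
  obtain ⟨α, β, γ, hE⟩ := hA.exists_isEquationSystem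
  refine ⟨h₁, h₂, hd, fun η hη => ?_⟩
  have hQ : (∏ L ∈ A, lin3 (α L) (β L) (γ L)).IsHomogeneous A.card := by
    have := IsHomogeneous.prod A (fun L => lin3 (α L) (β L) (γ L)) (fun _ => 1)
      fun L _ => lin3_isHomogeneous _ _ _
    simpa using this
  have hQ0 : ∏ L ∈ A, lin3 (α L) (β L) (γ L) ≠ 0 :=
    Finset.prod_ne_zero_iff.mpr fun L hL => lin3_ne_zero (hE.ne_zero L hL)
  obtain ⟨q, hq⟩ := hE.prod_dvd_pairDet h₁.1 h₂.1
  obtain ⟨f, hf⟩ := hE.prod_dvd_pairDet hη h₂.1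
  obtain ⟨g, hg⟩ := hE.prod_dvd_pairDet h₁.1 hη
  have hq0 : q.IsHomogeneous 0 := by
    refine hQ.of_mul_left hQ0 ?_
    rw [← hq, add_zero, ← hcard]
    exact pairDet_isHomogeneous h₁ h₂
  obtain ⟨u, rfl⟩ : ∃ u, q = C u :=
    ⟨_, totalDegree_eq_zero_iff_eq_C.mp (Nat.le_zero.mp hq0.totalDegree_le)⟩
  have hu : u ≠ 0 := by
    rintro rfl
    exact hd (by rw [hq, C_0, mul_zero])
  have huC : (C u⁻¹ * C u : MvPolynomial (Fin 3) K) = 1 := by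
    rw [← C_mul, inv_mul_cancel₀ hu, C_1]
  simp only [pairDet] at hq hf hg
  refine ⟨C u⁻¹ * f, C u⁻¹ * g, Prod.ext (mul_left_cancel₀ hQ0 ?_)
    (mul_left_cancel₀ hQ0 ?_)⟩
  · simp only [Prod.fst_add, Prod.smul_fst, smul_eq_mul]
    linear_combination -(∏ L ∈ A, lin3 (α L) (β L) (γ L)) * η.1 * huC - C u⁻¹ * η.1 * hq +
      C u⁻¹ * η₁.1 * hf + C u⁻¹ * η₂.1 * hg
  · simp only [Prod.snd_add, Prod.smul_snd, smul_eq_mul]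
    linear_combination -(∏ L ∈ A, lin3 (α L) (β L) (γ L)) * η.2 * huC - C u⁻¹ * η.2 * hq +
      C u⁻¹ * η₁.2 * hf + C u⁻¹ * η₂.2 * hg

end LogBasis

section Exponents

theorem exists_homogeneousComponent_mul (f : MvPolynomial (Fin 3) K) (d k : ℕ) :
    ∃ f' : MvPolynomial (Fin 3) K, f'.IsHomogeneous (k - d) ∧ (k < d → f' = 0) ∧
      ∀ p : MvPolynomial (Fin 3) K, p.IsHomogeneous d →
        homogeneousComponent k (f * p) = f' * p := by
  rcases lt_or_ge k d with hk | hk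
  · refine ⟨0, isHomogeneous_zero _ _ _, fun _ => rfl, fun p hp => ?_⟩
    rw [mul_comm, homogeneousComponent_mul_of_lt hp f hk, zero_mul]
  · refine ⟨homogeneousComponent (k - d) f, homogeneousComponent_isHomogeneous _ _,
      fun h => absurd hk (not_le.mpr h), fun p hp => ?_⟩
    have := homogeneousComponent_mul_of_isHomogeneous hp f (k - d)
    rwa [Nat.add_sub_cancel' hk, mul_comm p f, mul_comm p] at this

theorem IsLogBasis.exists_homogeneous {A : Finset (Set (K × K))} {d₁ d₂ k : ℕ}
    {η₁ η₂ η : MvPolynomial (Fin 3) K × MvPolynomial (Fin 3) K} (h : IsLogBasis A d₁ d₂ η₁ η₂)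
    (hη : η ∈ logDeg A k) : ∃ f g : MvPolynomial (Fin 3) K,
      f.IsHomogeneous (k - d₁) ∧ g.IsHomogeneous (k - d₂) ∧ (k < d₁ → f = 0) ∧
        (k < d₂ → g = 0) ∧ η = f • η₁ + g • η₂ := by
  obtain ⟨f, g, he⟩ := h.span η hη.1
  obtain ⟨f', hf1, hf2, hf3⟩ := exists_homogeneousComponent_mul f d₁ k
  obtain ⟨g', hg1, hg2, hg3⟩ := exists_homogeneousComponent_mul g d₂ k
  refine ⟨f', g', hf1, hg1, hf2, hg2, Prod.ext ?_ ?_⟩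
  · have := congrArg (homogeneousComponent k) (congrArg Prod.fst he)
    simpa only [homogeneousComponent_eq_self hη.2.1, Prod.fst_add, Prod.smul_fst, smul_eq_mul,
      map_add, hf3 _ h.mem₁.2.1, hg3 _ h.mem₂.2.1] using this
  · have := congrArg (homogeneousComponent k) (congrArg Prod.snd he)
    simpa only [homogeneousComponent_eq_self hη.2.2, Prod.snd_add, Prod.smul_snd, smul_eq_mul,
      map_add, hf3 _ h.mem₁.2.2, hg3 _ h.mem₂.2.2] using this

theorem smul_mem_logDeg {A : Finset (Set (K × K))} {d m : ℕ}
    {η : MvPolynomial (Fin 3) K × MvPolynomial (Fin 3) K} (hη : η ∈ logDeg A d)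
    {f : MvPolynomial (Fin 3) K} (hf : f.IsHomogeneous m) : f • η ∈ logDeg A (m + d) := by
  rw [mem_logDeg, Prod.smul_fst, Prod.smul_snd, smul_eq_mul, smul_eq_mul]
  exact ⟨Submodule.smul_mem _ _ hη.1, hf.mul hη.2.1, hf.mul hη.2.2⟩

theorem IsLogBasis.finrank_logDeg {A : Finset (Set (K × K))} {d₁ d₂ : ℕ}
    {η₁ η₂ : MvPolynomial (Fin 3) K × MvPolynomial (Fin 3) K} (h : IsLogBasis A d₁ d₂ η₁ η₂)
    {k₁ k₂ k : ℕ} (h₁ : k₁ + d₁ = k) (h₂ : k₂ + d₂ = k) :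
    Module.finrank K (logDeg A k) = (k₁ + 2).choose 2 + (k₂ + 2).choose 2 := by
  let F : (homogeneousSubmodule (Fin 3) K k₁ × homogeneousSubmodule (Fin 3) K k₂) →ₗ[K]
      logDeg A k :=
    { toFun := fun x => ⟨x.1.1 • η₁ + x.2.1 • η₂,
        Submodule.add_mem _ (h₁ ▸ smul_mem_logDeg h.mem₁ x.1.2)
          (h₂ ▸ smul_mem_logDeg h.mem₂ x.2.2)⟩
      map_add' := fun x y => Subtype.ext (by
        simp only [Prod.fst_add, Prod.snd_add, Submodule.coe_add, add_smul]
        abel)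
      map_smul' := fun u x => Subtype.ext (by
        simp only [Prod.smul_fst, Prod.smul_snd, Submodule.coe_smul, RingHom.id_apply, smul_add,
          smul_assoc]) }
  have hinj : Function.Injective F := by
    rw [injective_iff_map_eq_zero]
    intro x hx
    obtain ⟨z1, z2⟩ := eq_zero_of_smul_add_smul_eq_zero h.det_ne_zero (congrArg Subtype.val hx)
    exact Prod.ext (Subtype.ext z1) (Subtype.ext z2)
  have hsurj : Function.Surjective F := by
    rintro ⟨η, hη⟩
    obtain ⟨f, g, hf, hg, -, -, he⟩ := h.exists_homogeneous hη
    rw [← h₁, Nat.add_sub_cancel] at hf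
    rw [← h₂, Nat.add_sub_cancel] at hg
    exact ⟨(⟨f, hf⟩, ⟨g, hg⟩), Subtype.ext he.symm⟩
  rw [← (LinearEquiv.ofBijective F ⟨hinj, hsurj⟩).finrank_eq, Module.finrank_prod,
    finrank_homogeneousSubmodule_fin_three, finrank_homogeneousSubmodule_fin_three]

/-- The exponents of a free arrangement determine its number of lines and its second Betti
number. -/
theorem IsLogBasis.card_and_b2 {A : Finset (Set (K × K))} (hA : IsLineArr A) {d₁ d₂ : ℕ}
    {η₁ η₂ : MvPolynomial (Fin 3) K × MvPolynomial (Fin 3) K}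
    (h : IsLogBasis A d₁ d₂ η₁ η₂) : d₁ + d₂ = A.card ∧ b2 A = d₁ * d₂ := by
  have key : ∀ j : ℕ, 2 * (A.card + d₁ + d₂ + j + 2 : ℤ) * (A.card + d₁ + d₂ + j + 1) -
      2 * A.card * (A.card + d₁ + d₂ + j + 1) + A.card * (A.card - 1) - 2 * b2 A =
      (A.card + d₂ + j + 2) * (A.card + d₂ + j + 1) +
        (A.card + d₁ + j + 2) * (A.card + d₁ + j + 1) := by
    intro j
    have h1 := two_mul_finrank_logDeg hA (k := A.card + d₁ + d₂ + j) (by omega)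
    rw [h.finrank_logDeg (k₁ := A.card + d₂ + j) (k₂ := A.card + d₁ + j) (by omega)
      (by omega)] at h1
    have h2 := two_mul_choose_two (A.card + d₂ + j)
    have h3 := two_mul_choose_two (A.card + d₁ + j)
    push_cast at h1 h2 h3
    linear_combination -h1 + h2 + h3
  have k0 := key 0
  have k1 := key 1
  push_cast at k0 k1
  have hc : (d₁ : ℤ) + d₂ = A.card := by linarith
  refine ⟨by exact_mod_cast hc, ?_⟩
  rw [← hc] at k0
  linarith

theorem pairDet_smul_left (f : MvPolynomial (Fin 3) K)
    (η ξ : MvPolynomial (Fin 3) K × MvPolynomial (Fin 3) K) :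
    pairDet (f • η) ξ = f * pairDet η ξ := by
  simp only [pairDet, Prod.smul_fst, Prod.smul_snd, smul_eq_mul]
  ring

/-- If one member of a basis is divisible by a polynomial and the quotient is not logarithmic,
then some line of the arrangement can be removed while preserving freeness. -/
theorem IsLogBasis.exists_nOn_eq {A : Finset (Set (K × K))} (hA : IsLineArr A) {d₁ d₂ : ℕ}
    {θ η₂ : MvPolynomial (Fin 3) K × MvPolynomial (Fin 3) K} {f : MvPolynomial (Fin 3) K}
    (hθ : θ ∉ logModule A) (h : IsLogBasis A d₁ d₂ (f • θ) η₂) : ∃ H ∈ A, nOn A H = d₂ := by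
  classical
  rw [mem_logModule] at hθ
  push Not at hθ
  obtain ⟨H, hH, a, b, c, hab, rfl, hdvd⟩ := hθ
  refine ⟨_, hH, ?_⟩
  have hl := lin3_ne_zero (c := c) hab
  obtain ⟨f', rfl⟩ : lin3 a b c ∣ f := by
    refine ((lin3_prime hab).dvd_or_dvd ?_).resolve_right hdvd
    have := h.mem₁.1 _ hH a b c hab rfl
    simp only [Prod.smul_fst, Prod.smul_snd, smul_eq_mul] at this
    convert this using 1
    ring
  obtain ⟨hcard, hb2⟩ := h.card_and_b2 hA
  set A' := A.erase (affineLine a b c) with hA'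
  have hHA' : affineLine a b c ∉ A' := Finset.notMem_erase _ _
  have hins : insert (affineLine a b c) A' = A := Finset.insert_erase hH
  have hlA' : IsLineArr A' := fun L hL => hA L (Finset.mem_of_mem_erase hL)
  have hle : logModule A ≤ logModule A' := logModule_anti (Finset.erase_subset _ _)
  have hdet := h.det_ne_zero
  have h1 := h.mem₁
  rw [mul_smul] at h1 hdet
  rw [pairDet_smul_left] at hdet
  have hmem : f' • θ ∈ logModule A' := mem_logModule_of_smul hab hHA' (hle h1.1)
  obtain ⟨-, hh1, hh2⟩ := h1
  rw [Prod.smul_fst, smul_eq_mul] at hh1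
  rw [Prod.smul_snd, smul_eq_mul] at hh2
  have hd₁ : d₁ ≠ 0 := by
    rintro rfl
    have z1 := (lin3_isHomogeneous a b c).eq_zero_of_mul_left hh1 zero_lt_one
    have z2 := (lin3_isHomogeneous a b c).eq_zero_of_mul_left hh2 zero_lt_one
    refine right_ne_zero_of_mul hdet ?_
    rw [pairDet, (mul_eq_zero.mp z1).resolve_left hl, (mul_eq_zero.mp z2).resolve_left hl]
    ring
  obtain ⟨d, rfl⟩ := Nat.exists_eq_succ_of_ne_zero hd₁
  rw [Nat.succ_eq_one_add] at hh1 hh2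
  have hbasis : IsLogBasis A' d d₂ (f' • θ) η₂ :=
    isLogBasis_of_pairDet_ne_zero hlA'
      ⟨hmem, (lin3_isHomogeneous a b c).of_mul_left hl hh1,
        (lin3_isHomogeneous a b c).of_mul_left hl hh2⟩
      ⟨hle h.mem₂.1, h.mem₂.2⟩ (right_ne_zero_of_mul hdet) (by
        rw [Finset.card_erase_of_mem hH]; omega)
  obtain ⟨-, hb2'⟩ := hbasis.card_and_b2 hlA'
  have := b2_insert hlA' hab hHA'
  rw [hins, hb2, hb2'] at this
  push_cast at this
  have h3 : (nOn A (affineLine a b c) : ℤ) = d₂ := by linarith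
  exact_mod_cast h3

end Exponents

section Proportional

theorem exists_isRelPrime_smul {φ ψ : MvPolynomial (Fin 3) K × MvPolynomial (Fin 3) K}
    (h0 : φ ≠ 0) (hd : pairDet φ ψ = 0) :
    ∃ (g q : MvPolynomial (Fin 3) K) (ω : MvPolynomial (Fin 3) K × MvPolynomial (Fin 3) K),
      IsRelPrime g q ∧ φ = g • ω ∧ ψ = q • ω := by
  have key : ∀ f₁ f₂ p₁ p₂ : MvPolynomial (Fin 3) K, f₁ ≠ 0 → f₁ * p₂ - f₂ * p₁ = 0 →
      ∃ g q w₁ w₂ : MvPolynomial (Fin 3) K, IsRelPrime g q ∧ f₁ = g * w₁ ∧ f₂ = g * w₂ ∧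
        p₁ = q * w₁ ∧ p₂ = q * w₂ := by
    intro f₁ f₂ p₁ p₂ hf he
    obtain ⟨g, q, d, hgq, rfl, rfl⟩ := UniqueFactorizationMonoid.exists_reduced_factors f₁ hf p₁
    have hd : d ≠ 0 := left_ne_zero_of_mul hf
    have hg : g ≠ 0 := right_ne_zero_of_mul hf
    have h2 : g * p₂ = q * f₂ := mul_left_cancel₀ hd (by linear_combination he)
    obtain ⟨w, rfl⟩ : g ∣ f₂ := hgq.dvd_of_dvd_mul_left ⟨p₂, h2.symm⟩
    refine ⟨g, q, d, w, hgq, by ring, rfl, by ring, mul_left_cancel₀ hg ?_⟩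
    linear_combination h2
  rw [pairDet] at hd
  by_cases h1 : φ.1 = 0
  · have h2 : φ.2 ≠ 0 := fun h2 => h0 (Prod.ext h1 h2)
    obtain ⟨g, q, w₁, w₂, hgq, e1, e2, e3, e4⟩ := key φ.2 φ.1 ψ.2 ψ.1 h2
      (by linear_combination -hd)
    exact ⟨g, q, (w₂, w₁), hgq, Prod.ext e2 e1, Prod.ext e4 e3⟩
  · obtain ⟨g, q, w₁, w₂, hgq, e1, e2, e3, e4⟩ := key φ.1 φ.2 ψ.1 ψ.2 h1 hd
    exact ⟨g, q, (w₁, w₂), hgq, Prod.ext e1 e2, Prod.ext e3 e4⟩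

theorem mem_logModule_of_isRelPrime {A : Finset (Set (K × K))} {g q : MvPolynomial (Fin 3) K}
    {ω : MvPolynomial (Fin 3) K × MvPolynomial (Fin 3) K} (hgq : IsRelPrime g q)
    (hg : g • ω ∈ logModule A) (hq : q • ω ∈ logModule A) : ω ∈ logModule A := by
  intro L hL a b c h he
  have h1 := hg L hL a b c h he
  have h2 := hq L hL a b c h he
  simp only [Prod.smul_fst, Prod.smul_snd, smul_eq_mul] at h1 h2
  rw [show C a * (g * ω.1) + C b * (g * ω.2) = g * (C a * ω.1 + C b * ω.2) by ring] at h1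
  rw [show C a * (q * ω.1) + C b * (q * ω.2) = q * (C a * ω.1 + C b * ω.2) by ring] at h2
  by_contra hn
  exact (lin3_prime h).not_isUnit (hgq (((lin3_prime h).dvd_or_dvd h1).resolve_right hn)
    (((lin3_prime h).dvd_or_dvd h2).resolve_right hn))

theorem homogeneousComponent_mem_logDeg {A : Finset (Set (K × K))}
    {η : MvPolynomial (Fin 3) K × MvPolynomial (Fin 3) K} (hη : η ∈ logModule A) (k : ℕ) :
    (homogeneousComponent k η.1, homogeneousComponent k η.2) ∈ logDeg A k := by
  refine ⟨fun L hL a b c h he => ?_, homogeneousComponent_isHomogeneous _ _,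
    homogeneousComponent_isHomogeneous _ _⟩
  obtain ⟨u, hu⟩ := hη L hL a b c h he
  obtain ⟨v, -, -, hv⟩ := exists_homogeneousComponent_mul u 1 k
  refine ⟨v, ?_⟩
  have := congrArg (homogeneousComponent k) hu
  rw [mul_comm (lin3 a b c), hv _ (lin3_isHomogeneous a b c), map_add,
    homogeneousComponent_C_mul, homogeneousComponent_C_mul, mul_comm v] at this
  exact this

theorem le_totalDegree_of_homogeneousComponent {p : MvPolynomial (Fin 3) K} {d : ℕ} (hp : p ≠ 0)
    (h : ∀ k < d, homogeneousComponent k p = 0) : d ≤ p.totalDegree := by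
  by_contra! hd
  refine hp ?_
  rw [← sum_homogeneousComponent p]
  exact Finset.sum_eq_zero fun k hk => h k (by rw [Finset.mem_range] at hk; omega)

/-- Two proportional logarithmic derivations, the first of minimal degree, are related by a
homogeneous factor. -/
theorem exists_eq_smul_of_pairDet_eq_zero {A : Finset (Set (K × K))} {d₁ d₂ : ℕ}
    (hmin : ∀ k < d₁, ∀ η ∈ logDeg A k, η = 0)
    {φ ψ : MvPolynomial (Fin 3) K × MvPolynomial (Fin 3) K} (hφ : φ ∈ logDeg A d₁)
    (hψ : ψ ∈ logDeg A d₂) (h0 : φ ≠ 0) (hd : pairDet φ ψ = 0) :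
    ∃ f : MvPolynomial (Fin 3) K, f.IsHomogeneous (d₂ - d₁) ∧ ψ = f • φ := by
  obtain ⟨g, q, ω, hgq, rfl, rfl⟩ := exists_isRelPrime_smul h0 hd
  have hω := mem_logModule_of_isRelPrime hgq hφ.1 hψ.1
  have hz : ∀ k < d₁, homogeneousComponent k ω.1 = 0 ∧ homogeneousComponent k ω.2 = 0 :=
    fun k hk => Prod.ext_iff.mp (hmin k hk _ (homogeneousComponent_mem_logDeg hω k))
  have hg0 : g ≠ 0 := by
    rintro rfl
    exact h0 (zero_smul _ _)
  have hdeg : ∀ w : MvPolynomial (Fin 3) K, (∀ k < d₁, homogeneousComponent k w = 0) →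
      (g * w).IsHomogeneous d₁ → w ≠ 0 → g.totalDegree = 0 := by
    intro w hw hgw hw0
    have h1 := le_totalDegree_of_homogeneousComponent hw0 hw
    have h2 := totalDegree_mul_of_isDomain hg0 hw0
    rw [hgw.totalDegree (mul_ne_zero hg0 hw0)] at h2
    omega
  have hg : g.totalDegree = 0 := by
    by_cases h1 : ω.1 = 0
    · refine hdeg ω.2 (fun k hk => (hz k hk).2) hφ.2.2 fun h2 => h0 ?_
      rw [show ω = 0 from Prod.ext h1 h2, smul_zero]
    · exact hdeg ω.1 (fun k hk => (hz k hk).1) hφ.2.1 h1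
  obtain ⟨u, rfl⟩ : ∃ u, g = C u := ⟨_, totalDegree_eq_zero_iff_eq_C.mp hg⟩
  have hu : u ≠ 0 := by
    rintro rfl
    exact hg0 C_0
  have huC : (C u⁻¹ * C u : MvPolynomial (Fin 3) K) = 1 := by
    rw [← C_mul, inv_mul_cancel₀ hu, C_1]
  obtain ⟨f, hf, -, hf'⟩ := exists_homogeneousComponent_mul (q * C u⁻¹) d₁ d₂
  refine ⟨f, hf, Prod.ext ?_ ?_⟩
  · have h1 := hf' _ hφ.2.1
    have h2 : q * C u⁻¹ * ((C u : MvPolynomial (Fin 3) K) • ω).1 = (q • ω).1 := by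
      simp only [Prod.smul_fst, smul_eq_mul]
      linear_combination q * ω.1 * huC
    rwa [h2, homogeneousComponent_eq_self hψ.2.1] at h1
  · have h1 := hf' _ hφ.2.2
    have h2 : q * C u⁻¹ * ((C u : MvPolynomial (Fin 3) K) • ω).2 = (q • ω).2 := by
      simp only [Prod.smul_snd, smul_eq_mul]
      linear_combination q * ω.2 * huC
    rwa [h2, homogeneousComponent_eq_self hψ.2.2] at h1

end Proportional

section Criterion

theorem choose_two_sub_succ (k d : ℕ) :
    (k + 1 + 2 - d).choose 2 = (k + 2 - d).choose 2 + (k + 2 - d) := by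
  rcases lt_or_ge (k + 2) d with h | h
  · rw [show k + 1 + 2 - d = 0 by omega, show k + 2 - d = 0 by omega]
    rfl
  · rw [show k + 1 + 2 - d = (k + 2 - d) + 1 by omega, Nat.choose_succ_succ' _ 1,
      Nat.choose_one_right, add_comm]

theorem nOn_lt_card {A : Finset (Set (K × K))} (hA : IsLineArr A) {H : Set (K × K)}
    (hH : H ∈ A) : nOn A H < A.card := by
  classical
  obtain ⟨a, b, c, h, he⟩ := hA H hH
  change H = affineLine a b c at he
  subst he
  obtain ⟨α, β, γ, hE⟩ := IsLineArr.exists_isEquationSystem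
    (A := A.erase (affineLine a b c)) fun L hL => hA L (Finset.mem_of_mem_erase hL)
  obtain ⟨p, hp⟩ := affineLine_nonempty h c
  have := nOn_insert hE h (Finset.notMem_erase _ _) hp
  rw [Finset.insert_erase hH] at this
  rw [this]
  refine (Finset.card_image_le.trans (Finset.card_filter_le _ _)).trans_lt ?_
  exact Finset.card_erase_lt_of_mem hH

theorem finrank_logDeg_eq {A : Finset (Set (K × K))} (hA : IsLineArr A) {d₁ d₂ : ℕ}
    (hcard : d₁ + d₂ = A.card) (hb2 : b2 A = d₁ * d₂) {H : Set (K × K)} (hH : H ∈ A)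
    (hn : nOn A H = d₁ ∨ nOn A H = d₂) (k : ℕ) :
    Module.finrank K (logDeg A k) = (k + 2 - d₁).choose 2 + (k + 2 - d₂).choose 2 := by
  classical
  have hlt := nOn_lt_card hA hH
  obtain ⟨a, b, c, h, he⟩ := hA H hH
  change H = affineLine a b c at he
  subst he
  set A' := A.erase (affineLine a b c) with hA'
  have hHA' : affineLine a b c ∉ A' := Finset.notMem_erase _ _
  have hins : insert (affineLine a b c) A' = A := Finset.insert_erase hH
  have hlA' : IsLineArr A' := fun L hL => hA L (Finset.mem_of_mem_erase hL)
  have hc' : A'.card = A.card - 1 := Finset.card_erase_of_mem hH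
  have hstep : ∀ j, Module.finrank K (logDeg A (j + 1)) ≤ Module.finrank K (logDeg A j) +
      ((j + 2 - d₁) + (j + 2 - d₂)) := by
    intro j
    have h1 := finrank_logDeg_le_insert hlA' h hHA' j
    have h2 := finrank_logDeg_insert_succ_le hlA' h hHA' j
    rw [hins] at h1 h2
    omega
  have hzero : Module.finrank K (logDeg A 0) ≤ (2 - d₁).choose 2 + (2 - d₂).choose 2 := by
    have h1 := finrank_logDeg_insert_zero_le hlA' h hHA'
    rw [hins] at h1
    by_cases h0 : nOn A (affineLine a b c) = 0
    · rw [h0] at h1 hn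
      refine h1.trans ?_
      rcases hn with rfl | rfl
      · exact Nat.le_add_right 1 _
      · exact Nat.le_add_left 1 _
    · omega
  have hmono : Monotone fun j : ℕ => (((j + 2 - d₁).choose 2 + (j + 2 - d₂).choose 2 : ℕ) : ℤ) -
      (Module.finrank K (logDeg A j) : ℤ) := by
    refine monotone_nat_of_le_succ fun j => ?_
    have h1 := hstep j
    rw [choose_two_sub_succ, choose_two_sub_succ]
    omega
  have hlarge : (((k + A.card + 2 - d₁).choose 2 + (k + A.card + 2 - d₂).choose 2 : ℕ) : ℤ) =
      (Module.finrank K (logDeg A (k + A.card)) : ℤ) := by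
    have h1 := two_mul_finrank_logDeg hA (k := k + A.card) (by omega)
    have h2 := two_mul_choose_two (k + d₂)
    have h3 := two_mul_choose_two (k + d₁)
    rw [show k + A.card + 2 - d₁ = k + d₂ + 2 by omega,
      show k + A.card + 2 - d₂ = k + d₁ + 2 by omega]
    rw [hb2, ← hcard] at h1
    rw [← hcard]
    push_cast at *
    refine mul_left_cancel₀ (two_ne_zero (α := ℤ)) ?_
    linear_combination h2 + h3 - h1
  have m1 := hmono (Nat.zero_le k)
  have m2 := hmono (Nat.le_add_right k A.card)
  simp only [zero_add] at m1 m2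
  omega

theorem exists_isLogBasis_of_nOn_eq {A : Finset (Set (K × K))} (hA : IsLineArr A) {d₁ d₂ : ℕ}
    (hle : d₁ ≤ d₂) (hcard : d₁ + d₂ = A.card) (hb2 : b2 A = d₁ * d₂) {H : Set (K × K)}
    (hH : H ∈ A) (hn : nOn A H = d₁ ∨ nOn A H = d₂) : ∃ η₁ η₂, IsLogBasis A d₁ d₂ η₁ η₂ := by
  have hdim := finrank_logDeg_eq hA hcard hb2 hH hn
  have hmin : ∀ k < d₁, ∀ η ∈ logDeg A k, η = 0 := by
    intro k hk η hη
    have h1 : Module.finrank K (logDeg A k) = 0 := by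
      rw [hdim, Nat.choose_eq_zero_of_lt (by omega), Nat.choose_eq_zero_of_lt (by omega)]
    rw [Submodule.finrank_eq_zero] at h1
    rwa [h1, Submodule.mem_bot] at hη
  obtain ⟨φ, hφ, hφ0⟩ : ∃ φ ∈ logDeg A d₁, φ ≠ 0 := by
    refine Submodule.exists_mem_ne_zero_of_ne_bot fun h0 => ?_
    have h1 := hdim d₁
    rw [h0, finrank_bot, Nat.add_sub_cancel_left, Nat.choose_self] at h1
    omega
  let F : MvPolynomial (Fin 3) K →ₗ[K] MvPolynomial (Fin 3) K × MvPolynomial (Fin 3) K :=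
    (LinearMap.toSpanSingleton (MvPolynomial (Fin 3) K) _ φ).restrictScalars K
  obtain ⟨ψ, hψ, hψφ⟩ : ∃ ψ ∈ logDeg A d₂,
      ψ ∉ (homogeneousSubmodule (Fin 3) K (d₂ - d₁)).map F := by
    by_contra! hall
    have h1 := (Submodule.finrank_mono hall).trans (Submodule.finrank_map_le _ _)
    rw [hdim, finrank_homogeneousSubmodule_fin_three, Nat.add_sub_cancel_left,
      show d₂ + 2 - d₁ = d₂ - d₁ + 2 by omega] at h1
    simp at h1
  refine ⟨φ, ψ, isLogBasis_of_pairDet_ne_zero hA hφ hψ (fun h0 => hψφ ?_) hcard⟩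
  obtain ⟨f, hf, he⟩ := exists_eq_smul_of_pairDet_eq_zero hmin hφ hψ hφ0 h0
  exact ⟨f, hf, he.symm⟩

theorem IsLogBasis.symm {A : Finset (Set (K × K))} {d₁ d₂ : ℕ}
    {η₁ η₂ : MvPolynomial (Fin 3) K × MvPolynomial (Fin 3) K} (h : IsLogBasis A d₁ d₂ η₁ η₂) :
    IsLogBasis A d₂ d₁ η₂ η₁ := by
  refine ⟨h.mem₂, h.mem₁, fun h0 => h.det_ne_zero ?_, fun η hη => ?_⟩
  · rw [pairDet] at h0 ⊢
    linear_combination -h0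
  · obtain ⟨f, g, rfl⟩ := h.span η hη
    exact ⟨g, f, add_comm _ _⟩

/-- If a free arrangement contains a free subarrangement with suitable exponents, then some line
carries a number of intersection points equal to an exponent. -/
theorem IsLogBasis.exists_nOn_eq_of_subset {A B : Finset (Set (K × K))} (hA : IsLineArr A)
    (hBA : B ⊆ A) {d₁ d₂ e m : ℕ} (hle : d₁ ≤ d₂) (he : d₁ ≤ e) (hm : m < d₁)
    {φ ψ θ' θ : MvPolynomial (Fin 3) K × MvPolynomial (Fin 3) K} (h : IsLogBasis A d₁ d₂ φ ψ)
    (hB : IsLogBasis B e m θ' θ) : ∃ H ∈ A, nOn A H = d₁ ∨ nOn A H = d₂ := by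
  have hθ : θ ∉ logModule A := by
    intro hθ
    obtain ⟨f, g, -, -, hf, hg, hfg⟩ := h.exists_homogeneous ⟨hθ, hB.mem₂.2⟩
    rw [hf hm, hg (hm.trans_le hle), zero_smul, zero_smul, add_zero] at hfg
    refine hB.det_ne_zero ?_
    rw [hfg, pairDet]
    simp
  obtain ⟨c₁, c₂, hc₁, -, hc₁0, -, hφ⟩ :=
    hB.exists_homogeneous ⟨logModule_anti hBA h.mem₁.1, h.mem₁.2⟩
  obtain ⟨a₁, a₂, ha₁, -, -, -, hψ⟩ :=
    hB.exists_homogeneous ⟨logModule_anti hBA h.mem₂.1, h.mem₂.2⟩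
  by_cases h0 : c₁ = 0
  · rw [h0, zero_smul, zero_add] at hφ
    subst hφ
    obtain ⟨H, hH, hn⟩ := h.exists_nOn_eq hA hθ
    exact ⟨H, hH, Or.inr hn⟩
  · obtain rfl : d₁ = e := le_antisymm he (not_lt.mp fun hlt => h0 (hc₁0 hlt))
    rw [Nat.sub_self] at hc₁
    obtain ⟨u, rfl⟩ : ∃ u, c₁ = C u :=
      ⟨_, totalDegree_eq_zero_iff_eq_C.mp (Nat.le_zero.mp hc₁.totalDegree_le)⟩
    have hu : u ≠ 0 := by
      rintro rfl
      exact h0 C_0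
    have huC : (C u⁻¹ * C u : MvPolynomial (Fin 3) K) = 1 := by
      rw [← C_mul, inv_mul_cancel₀ hu, C_1]
    have hψ' : (a₂ - a₁ * C u⁻¹ * c₂) • θ = ψ - (a₁ * C u⁻¹) • φ := by
      have h1 : (a₁ * C u⁻¹ * C u) • θ' = a₁ • θ' := by rw [mul_assoc, huC, mul_one]
      rw [hψ, hφ, smul_add, smul_smul, smul_smul, h1, sub_smul]
      abel
    have hmem : (a₂ - a₁ * C u⁻¹ * c₂) • θ ∈ logDeg A d₂ := by
      rw [hψ']
      refine Submodule.sub_mem _ h.mem₂ ?_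
      have := smul_mem_logDeg h.mem₁ (ha₁.mul (isHomogeneous_C (Fin 3) u⁻¹))
      rwa [add_zero, Nat.sub_add_cancel hle] at this
    have hdet : pairDet ((a₂ - a₁ * C u⁻¹ * c₂) • θ) φ ≠ 0 := by
      have h1 : pairDet ((a₂ - a₁ * C u⁻¹ * c₂) • θ) φ = -pairDet φ ψ := by
        rw [hψ']
        simp only [pairDet, Prod.fst_sub, Prod.snd_sub, Prod.smul_fst, Prod.smul_snd, smul_eq_mul]
        ring
      rw [h1]
      exact neg_ne_zero.mpr h.det_ne_zero
    obtain ⟨H, hH, hn⟩ := (isLogBasis_of_pairDet_ne_zero hA hmem h.mem₁ hdet (by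
      rw [add_comm, (h.card_and_b2 hA).1])).exists_nOn_eq hA hθ
    exact ⟨H, hH, Or.inl hn⟩

end Criterion

/-- **Proposition 4.2**. Let `|A| = 2n + r`, `χ(A,t) = (t−n)(t−n−r)`, and assume `A`
contains a free subarrangement `B` with `exp₀(B) = (n−s, n−1)` where `−r ≤ s ≤ 0`.
Then `A` is free iff `n_H ∈ {n, n+r}` for some `H ∈ A`. -/
theorem free_iff_exists_line_nonpositive_s
    {K : Type*} [Field K] (A : Finset (Set (K × K))) (hA : IsLineArr A)
    (n r : ℕ) (hcard : A.card = 2 * n + r)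
    (hchi : ∀ t : ℂ, chi A t = (t - (n : ℂ)) * (t - (n : ℂ) - (r : ℂ)))
    (B : Finset (Set (K × K))) (hBA : B ⊆ A)
    (s : ℤ) (hs1 : -(r : ℤ) ≤ s) (hs2 : s ≤ 0)
    (hBfree : IsFreeExpZ B ((n : ℤ) - s) ((n : ℤ) - 1)) :
    IsFree A ↔ ∃ H ∈ A, nOn A H = n ∨ nOn A H = n + r := by
  have hb2 : b2 A = (n : ℤ) * (n + r : ℕ) := by
    have h0 := hchi 0
    simp only [chi] at h0
    have h1 : ((b2 A : ℤ) : ℂ) = ((n * (n + r : ℕ) : ℤ) : ℂ) := by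
      push_cast
      linear_combination h0
    exact_mod_cast h1
  constructor
  · rintro ⟨d₁, d₂, hfree⟩
    obtain ⟨η₁, η₂, h⟩ := hfree.exists_isLogBasis
    obtain ⟨e, m, he, hm, hBexp⟩ := hBfree
    obtain ⟨θ', θ, hB⟩ := hBexp.exists_isLogBasis
    obtain ⟨h1, h2⟩ := h.card_and_b2 hA
    have hroot : ((d₁ : ℤ) - n) * (d₁ - (n + r : ℕ)) = 0 := by
      have h3 : (d₁ : ℤ) + d₂ = 2 * n + r := by exact_mod_cast h1.trans hcard
      rw [hb2] at h2
      push_cast at h2 ⊢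
      linear_combination (d₁ : ℤ) * h3 + h2
    rcases mul_eq_zero.mp hroot with hr | hr
    · obtain rfl : d₁ = n := by omega
      obtain rfl : d₂ = d₁ + r := by omega
      exact h.exists_nOn_eq_of_subset hA hBA (by omega) (by omega) (by omega) hB
    · obtain rfl : d₂ = n := by omega
      obtain rfl : d₁ = d₂ + r := by omega
      exact h.symm.exists_nOn_eq_of_subset hA hBA (by omega) (by omega) (by omega) hB
  · rintro ⟨H, hH, hn⟩
    obtain ⟨η₁, η₂, h⟩ := exists_isLogBasis_of_nOn_eq hA (Nat.le_add_right n r) (by omega)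
      hb2 hH hn
    exact ⟨n, n + r, h.isFreeExp⟩
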